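/- arXiv:0804.0493 — 3 statements merged into one kernel-verified Lean document; each statement's English description precedes it below -/
import Mathlib

section
/- Let Γ be an infinite, cyclic, free, properly discontinuous group of automorphisms of the bidisc Δ² ⊂ ℂ². Then there exists a negative continuous plurisubharmonic function ψ on Δ² with ψ > −∞ on Δ² and ψ(z) → −∞ as z → ⋃_{a∈D} CΓ_a (D a fundamental domain of Γ, CΓ_a the cluster set of the orbit of a). In particular, Δ²/Γ is a Stein manifold. -/
open Set Metric Filter MeasureTheory Topology

noncomputable section

variable {E : Type*} [NormedAddCommGroup E] [NormedSpace ℂ E]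

/-- `f` is an automorphism (biholomorphic self-map) of the domain `Ω`. -/
def IsAutOn (Ω : Set E) (f : E → E) : Prop :=
  DifferentiableOn ℂ f Ω ∧ MapsTo f Ω Ω ∧
    ∃ g : E → E, DifferentiableOn ℂ g Ω ∧ MapsTo g Ω Ω ∧
      EqOn (g ∘ f) id Ω ∧ EqOn (f ∘ g) id Ω

/-- `Γ` is a group of automorphisms of the domain `Ω`. -/
structure IsAutGroupOn (Ω : Set E) (Γ : Set (E → E)) : Prop where
  aut : ∀ γ ∈ Γ, IsAutOn Ω γ
  id_mem : id ∈ Γ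
  comp_mem : ∀ γ ∈ Γ, ∀ σ ∈ Γ, γ ∘ σ ∈ Γ
  inv_mem : ∀ γ ∈ Γ, ∃ σ ∈ Γ, EqOn (σ ∘ γ) id Ω ∧ EqOn (γ ∘ σ) id Ω

/-- `Γ` acts properly discontinuously on `Ω`: for any pair of compact subsets of `Ω`
only finitely many elements of `Γ` move the first one into the second one. -/
def ProperlyDiscontinuousOn (Ω : Set E) (Γ : Set (E → E)) : Prop :=
  ∀ K₁ K₂ : Set E, K₁ ⊆ Ω → K₂ ⊆ Ω → IsCompact K₁ → IsCompact K₂ →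
    {γ ∈ Γ | (γ '' K₁ ∩ K₂).Nonempty}.Finite

/-- The action of `Γ` on `Ω` is free: an element with a fixed point acts as the identity. -/
def FreeActionOn (Ω : Set E) (Γ : Set (E → E)) : Prop :=
  ∀ γ ∈ Γ, (∃ z ∈ Ω, γ z = z) → EqOn γ id Ω

/-- Plurisubharmonicity of an `EReal`-valued function `u` on `Ω`: `u` is upper
semicontinuous and, on every closed disc inside `Ω` on every complex line, `u` is dominated
by any harmonic function (real part of a holomorphic function) dominating it on the
boundary circle. -/
def IsPSHOn (u : E → EReal) (Ω : Set E) : Prop :=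
  UpperSemicontinuousOn u Ω ∧
  ∀ z v : E, ∀ r : ℝ, 0 < r → (∀ w : ℂ, ‖w‖ ≤ r → z + w • v ∈ Ω) →
    ∀ f : ℂ → ℂ, Differentiable ℂ f →
      (∀ w : ℂ, ‖w‖ = r → u (z + w • v) ≤ ((f w).re : EReal)) →
      ∀ w : ℂ, ‖w‖ ≤ r → u (z + w • v) ≤ ((f w).re : EReal)

/-- Plurisubharmonicity for a real-valued function. -/
def IsPSHOnR (u : E → ℝ) (Ω : Set E) : Prop :=
  IsPSHOn (fun z => (u z : EReal)) Ω

/-- The Laplacian at `0` of `w ↦ u (z + w • v)`, `w ∈ ℂ`; up to the factor `1/4` this is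
the Levi form of `u` at `z` evaluated at the direction `v`. -/
def lineLaplacian (u : E → ℝ) (z v : E) : ℝ :=
  deriv (deriv fun t : ℝ => u (z + (t : ℂ) • v)) 0 +
  deriv (deriv fun t : ℝ => u (z + ((t : ℂ) * Complex.I) • v)) 0

/-- Strict plurisubharmonicity (for a `C²` function): the Levi form is positive definite
at every point of `Ω`. -/
def IsStrictPSHOn (u : E → ℝ) (Ω : Set E) : Prop :=
  ∀ z ∈ Ω, ∀ v : E, v ≠ 0 → 0 < lineLaplacian u z v

/-- The quotient manifold `Ω/Γ` is Stein: `Γ`-invariant holomorphic functions (that is,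
holomorphic functions of the quotient) separate the points of the quotient, and the
quotient is holomorphically convex: the holomorphically convex hull (in the quotient) of
any compact set is compact, i.e. is contained in the `Γ`-saturation of a compact subset
of `Ω`. -/
def QuotientIsStein (Ω : Set E) (Γ : Set (E → E)) : Prop :=
  (∀ z ∈ Ω, ∀ w ∈ Ω, (∀ γ ∈ Γ, γ z ≠ w) →
      ∃ f : E → ℂ, DifferentiableOn ℂ f Ω ∧ (∀ γ ∈ Γ, ∀ x ∈ Ω, f (γ x) = f x) ∧
        f z ≠ f w) ∧
  (∀ K : Set E, K ⊆ Ω → IsCompact K → ∃ L : Set E, L ⊆ Ω ∧ IsCompact L ∧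
      {z ∈ Ω | ∀ f : E → ℂ, DifferentiableOn ℂ f Ω →
          (∀ γ ∈ Γ, ∀ x ∈ Ω, f (γ x) = f x) →
          ‖f z‖ ≤ sSup ((fun x => ‖f x‖) '' K)} ⊆ ⋃ γ ∈ Γ, γ '' L)

/-- The quotient manifold `Ω/Γ` possesses a negative `C^∞` strictly plurisubharmonic
function, i.e. there is a `Γ`-invariant negative `C^∞` strictly plurisubharmonic function
on `Ω`. -/
def QuotientHasNegSPSH (Ω : Set E) (Γ : Set (E → E)) : Prop :=
  ∃ u : E → ℝ, (∀ γ ∈ Γ, ∀ z ∈ Ω, u (γ z) = u z) ∧ (∀ z ∈ Ω, u z < 0) ∧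
    ContDiffOn ℝ (⊤ : ℕ∞) u Ω ∧ IsStrictPSHOn u Ω

/-- The pluricomplex Green function of `Ω` with pole `w`. -/
def pcGreen (Ω : Set E) (z w : E) : EReal :=
  sSup {t : EReal | ∃ u : E → EReal, IsPSHOn u Ω ∧ (∀ x ∈ Ω, u x < 0) ∧
    (∃ C : ℝ, ∀ᶠ x in 𝓝[Ω \ {w}] w, u x ≤ ((Real.log ‖x - w‖ + C : ℝ) : EReal)) ∧
    t = u z}

/-- The pluricomplex Green function of `Ω` with pole `w` exists: it has a logarithmic
pole at `w` and is bounded away from `-∞` outside a neighborhood of `w`. -/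
def GreenExistsAt (Ω : Set E) (w : E) : Prop :=
  (∃ C : ℝ, ∀ᶠ z in 𝓝[Ω \ {w}] w,
      ((Real.log ‖z - w‖ - C : ℝ) : EReal) ≤ pcGreen Ω z w ∧
        pcGreen Ω z w ≤ ((Real.log ‖z - w‖ + C : ℝ) : EReal)) ∧
  ∃ r : ℝ, 0 < r ∧ ∃ C : ℝ, ∀ z ∈ Ω, z ∉ ball w r → ((-C : ℝ) : EReal) ≤ pcGreen Ω z w

/-- `Ω` is pluricomplex hyperbolic. -/
def PlcpxHyperbolic (Ω : Set E) : Prop :=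
  ∀ w ∈ Ω, GreenExistsAt Ω w

/-- `Ω` is a Stein domain: it is open, holomorphically convex, and holomorphic functions
separate its points. -/
def IsSteinDomain (Ω : Set E) : Prop :=
  IsOpen Ω ∧
  (∀ K : Set E, K ⊆ Ω → IsCompact K →
      IsCompact {z ∈ Ω | ∀ f : E → ℂ, DifferentiableOn ℂ f Ω →
        ‖f z‖ ≤ sSup ((fun x => ‖f x‖) '' K)}) ∧
  ∀ z ∈ Ω, ∀ w ∈ Ω, z ≠ w → ∃ f : E → ℂ, DifferentiableOn ℂ f Ω ∧ f z ≠ f w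

/-- The pluricomplex Green function of the quotient `Ω/Γ` with pole `π w`, pulled back to
`Ω`: the supremum of all `Γ`-invariant negative plurisubharmonic functions on `Ω` with a
logarithmic pole at `w`. -/
def quotGreen (Ω : Set E) (Γ : Set (E → E)) (z w : E) : EReal :=
  sSup {t : EReal | ∃ u : E → EReal, IsPSHOn u Ω ∧ (∀ x ∈ Ω, u x < 0) ∧
    (∀ γ ∈ Γ, ∀ x ∈ Ω, u (γ x) = u x) ∧
    (∃ C : ℝ, ∀ᶠ x in 𝓝[Ω \ {w}] w, u x ≤ ((Real.log ‖x - w‖ + C : ℝ) : EReal)) ∧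
    t = u z}

/-- The pluricomplex Green function of the quotient `Ω/Γ` with pole `π w` exists. -/
def QuotientGreenExistsAt (Ω : Set E) (Γ : Set (E → E)) (w : E) : Prop :=
  (∃ C : ℝ, ∀ᶠ z in 𝓝[Ω \ {w}] w,
      ((Real.log ‖z - w‖ - C : ℝ) : EReal) ≤ quotGreen Ω Γ z w ∧
        quotGreen Ω Γ z w ≤ ((Real.log ‖z - w‖ + C : ℝ) : EReal)) ∧
  ∃ r : ℝ, 0 < r ∧ ∃ C : ℝ, ∀ z ∈ Ω, (∀ γ ∈ Γ, γ z ∉ ball w r) →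
    ((-C : ℝ) : EReal) ≤ quotGreen Ω Γ z w

/-- The quotient `Ω/Γ` is pluricomplex hyperbolic. -/
def QuotientPlcpxHyperbolic (Ω : Set E) (Γ : Set (E → E)) : Prop :=
  ∀ w ∈ Ω, QuotientGreenExistsAt Ω Γ w

/-- `D` is a fundamental domain for the action of `Γ` on `Ω`. -/
def IsFundamentalDomainOn (Ω : Set E) (Γ : Set (E → E)) (D : Set E) : Prop :=
  D ⊆ Ω ∧ (∀ z ∈ Ω, ∃ γ ∈ Γ, γ z ∈ D) ∧
    ∀ z ∈ D, ∀ w ∈ D, (∃ γ ∈ Γ, γ z = w) → z = w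

/-- The orbit of the point `a` under `Γ`. -/
def orbitOf (Γ : Set (E → E)) (a : E) : Set E := (fun γ : E → E => γ a) '' Γ

/-- The set of cluster (accumulation) points of the orbit of `a` under `Γ`. -/
def clusterPtsOfOrbit (Γ : Set (E → E)) (a : E) : Set E :=
  {b : E | AccPt b (𝓟 (orbitOf Γ a))}

/-- The limit set of `Γ` acting on the bounded domain `Ω`. -/
def limitSet (Ω : Set E) (Γ : Set (E → E)) : Set E :=
  {w ∈ frontier Ω | ∃ K : Set E, K ⊆ Ω ∧ IsCompact K ∧
    ∃ z : ℕ → E, (∀ k, z k ∈ Ω) ∧ Tendsto z atTop (𝓝 w) ∧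
      ∃ γ : ℕ → E → E, (∀ k, γ k ∈ Γ) ∧ ∀ k, γ k (z k) ∈ K}

/-- `ψ` is a barrier at the boundary point `p` of `Ω`. -/
def IsBarrierAt (Ω : Set E) (p : E) (ψ : E → ℝ) : Prop :=
  ContinuousOn ψ (closure Ω) ∧ IsPSHOnR ψ Ω ∧ ψ p = 0 ∧
    ∀ z ∈ closure Ω, z ≠ p → ψ z < 0

/-- `Ω` is B-regular: there is a barrier at every boundary point. -/
def BRegular (Ω : Set E) : Prop :=
  ∀ p ∈ frontier Ω, ∃ ψ : E → ℝ, IsBarrierAt Ω p ψ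

/-- Integer iterates of a map `f` with (two-sided) inverse `g`. -/
def zIter (f g : E → E) : ℤ → E → E
  | Int.ofNat k => f^[k]
  | Int.negSucc k => g^[k + 1]

/-- `Γ` is an (algebraically) cyclic group of automorphisms of `Ω`: it consists of the
integer powers of a single automorphism. -/
def IsCyclicAutGroupOn (Ω : Set E) (Γ : Set (E → E)) : Prop :=
  ∃ γ ∈ Γ, ∃ γ' ∈ Γ, EqOn (γ' ∘ γ) id Ω ∧ EqOn (γ ∘ γ') id Ω ∧
    (∀ k : ℤ, zIter γ γ' k ∈ Γ) ∧ ∀ σ ∈ Γ, ∃ k : ℤ, EqOn σ (zIter γ γ' k) Ω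

/-- The complex Jacobian determinant of `γ` at `z`. -/
def jacDet (γ : E → E) (z : E) : ℂ :=
  LinearMap.det ((fderiv ℂ γ z : E →L[ℂ] E) : E →ₗ[ℂ] E)

/-- The Möbius transformation `z ↦ (u z + a) / (1 + ā u z)`; it is an automorphism of the unit
disc when `‖u‖ = 1` and `‖a‖ < 1`. -/
def discMoebius (u a z : ℂ) : ℂ := (u * z + a) / (1 + star a * u * z)

lemma discMoebius_denom_ne_zero {u a z : ℂ} (hu : ‖u‖ = 1) (ha : ‖a‖ < 1) (hz : ‖z‖ < 1) :
    1 + star a * u * z ≠ 0 := by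
  intro h
  have h1 : star a * u * z = -1 := by linear_combination h
  have h2 : ‖a‖ * ‖z‖ = 1 := by simpa [hu] using congrArg norm h1
  nlinarith [norm_nonneg a, norm_nonneg z]

lemma one_sub_normSq_discMoebius {u a z : ℂ} (hu : ‖u‖ = 1) :
    Complex.normSq (1 + star a * u * z) - Complex.normSq (u * z + a) =
      (1 - Complex.normSq a) * (1 - Complex.normSq z) := by
  have hu' : u * star u = 1 := by
    have := Complex.mul_conj u
    rw [Complex.normSq_eq_norm_sq, hu] at this
    simpa using this
  apply Complex.ofReal_injective
  push_cast
  simp only [← Complex.mul_conj, starRingEnd_apply, star_add, star_mul', star_one, star_star]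
  linear_combination (a * star a * z * star z - z * star z) * hu'

lemma norm_discMoebius_lt_one {u a z : ℂ} (hu : ‖u‖ = 1) (ha : ‖a‖ < 1) (hz : ‖z‖ < 1) :
    ‖discMoebius u a z‖ < 1 := by
  have hd := discMoebius_denom_ne_zero hu ha hz
  have h := one_sub_normSq_discMoebius (a := a) (z := z) hu
  simp only [Complex.normSq_eq_norm_sq] at h
  rw [discMoebius, norm_div, div_lt_one (norm_pos_iff.2 hd)]
  refine lt_of_pow_lt_pow_left₀ 2 (norm_nonneg _) ?_
  have h1 : 0 < (1 - ‖a‖ ^ 2) * (1 - ‖z‖ ^ 2) := by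
    apply mul_pos <;> nlinarith [norm_nonneg a, norm_nonneg z]
  linarith

lemma discMoebius_mapsTo {u a : ℂ} (hu : ‖u‖ = 1) (ha : ‖a‖ < 1) :
    MapsTo (discMoebius u a) (ball 0 1) (ball 0 1) := by
  intro z hz
  rw [mem_ball_zero_iff] at *
  exact norm_discMoebius_lt_one hu ha hz

lemma discMoebius_differentiableOn {u a : ℂ} (hu : ‖u‖ = 1) (ha : ‖a‖ < 1) :
    DifferentiableOn ℂ (discMoebius u a) (ball 0 1) := by
  unfold discMoebius
  refine DifferentiableOn.div (by fun_prop) (by fun_prop) fun z hz => ?_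
  exact discMoebius_denom_ne_zero hu ha (mem_ball_zero_iff.1 hz)

lemma discMoebius_neg_comp {a z : ℂ} (ha : ‖a‖ < 1) (hz : ‖z‖ < 1) :
    discMoebius 1 (-a) (discMoebius 1 a z) = z := by
  have hd := discMoebius_denom_ne_zero (u := 1) (by simp) ha hz
  have hd' := discMoebius_denom_ne_zero (u := 1) (by simp) (a := -a) (by simpa using ha)
    (norm_discMoebius_lt_one (u := 1) (by simp) ha hz)
  have hw : discMoebius 1 a z * (1 + star a * 1 * z) = 1 * z + a := div_mul_cancel₀ _ hd
  rw [discMoebius, div_eq_iff hd', star_neg]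
  linear_combination hw

/-- A holomorphic function on the bidisc bounded by the sup norm, with equality at `(1/2, 0)`,
is a rotation of the first coordinate. -/
lemma exists_eq_mul_fst_of_norm_le {g : ℂ × ℂ → ℂ}
    (hg : DifferentiableOn ℂ g (ball (0 : ℂ) 1 ×ˢ ball (0 : ℂ) 1))
    (hle : ∀ z ∈ ball (0 : ℂ) 1 ×ˢ ball (0 : ℂ) 1, ‖g z‖ ≤ ‖z‖)
    (heq : ‖g (1 / 2, 0)‖ = 1 / 2) :
    ∃ u : ℂ, ‖u‖ = 1 ∧ ∀ z ∈ ball (0 : ℂ) 1 ×ˢ ball (0 : ℂ) 1, g z = u * z.1 := by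
  have hg0 : g 0 = 0 := by
    have := hle 0 (by simp)
    simpa using this
  have hsl1 : DifferentiableOn ℂ (fun t : ℂ => g (t, 0)) (ball 0 1) :=
    hg.comp (f := fun t : ℂ => (t, (0 : ℂ))) (by fun_prop) (fun t ht => by simpa using ht)
  have hsl2 : ∀ a ∈ ball (0 : ℂ) 1, DifferentiableOn ℂ (fun t : ℂ => g (a, t)) (ball 0 1) :=
    fun a ha => hg.comp (f := fun t : ℂ => (a, t)) (by fun_prop)
      (fun t ht => by simpa using ⟨by simpa using ha, by simpa using ht⟩)
  obtain ⟨u, hu, hgu⟩ := Complex.affine_of_mapsTo_ball_of_exists_norm_dslope_eq_div' (R₂ := 1) hsl1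
    (fun t ht => by
      have h := hle (t, 0) (by simpa using ht)
      have h0 : g (0, 0) = 0 := hg0
      simp only [mem_ball_zero_iff] at ht
      simp only [h0, mem_closedBall_zero_iff]
      simp [Prod.norm_def] at h
      linarith)
    ⟨1 / 2, by simp; norm_num, by
      have h0 : g (0, 0) = 0 := hg0
      rw [dslope_of_ne _ (by norm_num), slope_def_field, norm_div]
      simp only [h0, sub_zero, heq]
      norm_num⟩
  have hu1 : ‖u‖ = 1 := by simpa using hu
  have hg1 : ∀ t ∈ ball (0 : ℂ) 1, g (t, 0) = u * t := fun t ht => by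
    have h := hgu ht
    have h0 : g (0, 0) = 0 := hg0
    simp only [h0] at h
    rw [h]; simp [mul_comm]
  have key : ∀ a ∈ ball (0 : ℂ) 1, a ≠ 0 → ∀ t ∈ ball (0 : ℂ) 1, g (a, t) = u * a := by
    intro a ha ha0
    have ha1 : ‖a‖ < 1 := by simpa using ha
    have hsub : ball (0 : ℂ) ‖a‖ ⊆ ball 0 1 := ball_subset_ball ha1.le
    have hmax : EqOn (fun t => g (a, t)) (Function.const ℂ (g (a, 0))) (ball 0 ‖a‖) := by
      refine Complex.eqOn_of_isPreconnected_of_isMaxOn_norm (convex_ball _ _).isPreconnected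
        isOpen_ball ((hsl2 a ha).mono hsub) (by simpa using ha0) fun t ht => ?_
      have h := hle (a, t) ⟨ha, hsub ht⟩
      have ht' : ‖t‖ < ‖a‖ := by simpa using ht
      simp only [mem_ofPred_eq, Function.comp, hg1 a ha, norm_mul, hu1, one_mul]
      rwa [Prod.norm_def, max_eq_left ht'.le] at h
    have hid := (((hsl2 a ha).analyticOnNhd isOpen_ball)).eqOn_of_preconnected_of_eventuallyEq
      (g := fun _ => u * a) analyticOnNhd_const (convex_ball _ _).isPreconnected
      (mem_ball_self one_pos) (by
        filter_upwards [ball_mem_nhds (0 : ℂ) (norm_pos_iff.2 ha0)] with t ht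
        exact (hmax ht).trans (hg1 a ha))
    exact fun t ht => hid ht
  refine ⟨u, hu1, fun z hz => ?_⟩
  obtain ⟨a, t⟩ := z
  obtain ⟨ha, ht⟩ := hz
  simp only at ha ht ⊢
  by_cases ha0 : a = 0
  · subst ha0
    have hc : ContinuousOn (fun s : ℂ => g (s, t)) (ball 0 1) :=
      hg.continuousOn.comp (f := fun s : ℂ => (s, t)) (by fun_prop) (fun s hs => ⟨hs, ht⟩)
    have h1 : Tendsto (fun s : ℂ => g (s, t)) (𝓝[≠] 0) (𝓝 (g (0, t))) :=
      ((hc.continuousAt (ball_mem_nhds _ one_pos)).tendsto).mono_left nhdsWithin_le_nhds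
    have h2 : Tendsto (fun s : ℂ => u * s) (𝓝[≠] 0) (𝓝 (u * 0)) :=
      ((continuous_const.mul continuous_id).tendsto 0).mono_left nhdsWithin_le_nhds
    refine tendsto_nhds_unique (h1.congr' ?_) h2
    filter_upwards [self_mem_nhdsWithin, nhdsWithin_le_nhds (ball_mem_nhds (0 : ℂ) one_pos)]
      with s hs hs'
    exact key s hs' hs t ht
  · exact key a ha ha0 t ht

lemma exists_eq_mul_snd_of_norm_le {g : ℂ × ℂ → ℂ}
    (hg : DifferentiableOn ℂ g (ball (0 : ℂ) 1 ×ˢ ball (0 : ℂ) 1))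
    (hle : ∀ z ∈ ball (0 : ℂ) 1 ×ˢ ball (0 : ℂ) 1, ‖g z‖ ≤ ‖z‖)
    (heq : ‖g (0, 1 / 2)‖ = 1 / 2) :
    ∃ u : ℂ, ‖u‖ = 1 ∧ ∀ z ∈ ball (0 : ℂ) 1 ×ˢ ball (0 : ℂ) 1, g z = u * z.2 := by
  obtain ⟨u, hu, h⟩ := exists_eq_mul_fst_of_norm_le (g := fun z => g (z.2, z.1))
    (hg.comp (f := fun z : ℂ × ℂ => (z.2, z.1)) (by fun_prop) (fun z hz => ⟨hz.2, hz.1⟩))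
    (fun z hz => (hle (z.2, z.1) ⟨hz.2, hz.1⟩).trans_eq (by simp [Prod.norm_def, max_comm])) heq
  exact ⟨u, hu, fun z hz => h (z.2, z.1) ⟨hz.2, hz.1⟩⟩

/-- Automorphisms of the bidisc fixing the origin are rotations in each coordinate, up to a
permutation of the coordinates. -/
lemma bidisc_aut_fixing_zero {T S : ℂ × ℂ → ℂ × ℂ}
    (hT : DifferentiableOn ℂ T (ball (0 : ℂ) 1 ×ˢ ball (0 : ℂ) 1))
    (hTm : MapsTo T (ball (0 : ℂ) 1 ×ˢ ball (0 : ℂ) 1) (ball (0 : ℂ) 1 ×ˢ ball (0 : ℂ) 1))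
    (hS : DifferentiableOn ℂ S (ball (0 : ℂ) 1 ×ˢ ball (0 : ℂ) 1))
    (hSm : MapsTo S (ball (0 : ℂ) 1 ×ˢ ball (0 : ℂ) 1) (ball (0 : ℂ) 1 ×ˢ ball (0 : ℂ) 1))
    (hST : ∀ z ∈ ball (0 : ℂ) 1 ×ˢ ball (0 : ℂ) 1, S (T z) = z) (h0 : T 0 = 0) :
    ∃ u v : ℂ, ‖u‖ = 1 ∧ ‖v‖ = 1 ∧
      ((∀ z ∈ ball (0 : ℂ) 1 ×ˢ ball (0 : ℂ) 1, T z = (u * z.1, v * z.2)) ∨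
        ∀ z ∈ ball (0 : ℂ) 1 ×ˢ ball (0 : ℂ) 1, T z = (u * z.2, v * z.1)) := by
  have hball : ball (0 : ℂ) 1 ×ˢ ball (0 : ℂ) 1 = ball (0 : ℂ × ℂ) 1 := ball_prod_same _ _ _
  have hS0 : S 0 = 0 := by simpa [h0] using hST 0 (by simp)
  have hTle : ∀ z ∈ ball (0 : ℂ) 1 ×ˢ ball (0 : ℂ) 1, ‖T z‖ ≤ ‖z‖ := by
    intro z hz
    rw [hball] at hT hTm hz
    exact Complex.norm_le_norm_of_mapsTo_ball hT (hTm.mono_right ball_subset_closedBall) h0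
      (mem_ball_zero_iff.1 hz)
  have hTge : ∀ z ∈ ball (0 : ℂ) 1 ×ˢ ball (0 : ℂ) 1, ‖z‖ ≤ ‖T z‖ := by
    intro z hz
    have hz' := hTm hz
    have h := hST z hz
    rw [hball] at hS hSm hz'
    have := Complex.norm_le_norm_of_mapsTo_ball hS (hSm.mono_right ball_subset_closedBall) hS0
      (mem_ball_zero_iff.1 hz')
    rwa [h] at this
  have hT1 := hT.fst
  have hT2 := hT.snd
  have hle1 : ∀ z ∈ ball (0 : ℂ) 1 ×ˢ ball (0 : ℂ) 1, ‖(T z).1‖ ≤ ‖z‖ :=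
    fun z hz => (norm_fst_le _).trans (hTle z hz)
  have hle2 : ∀ z ∈ ball (0 : ℂ) 1 ×ˢ ball (0 : ℂ) 1, ‖(T z).2‖ ≤ ‖z‖ :=
    fun z hz => (norm_snd_le _).trans (hTle z hz)
  have hm1 : ((1 / 2, 0) : ℂ × ℂ) ∈ ball (0 : ℂ) 1 ×ˢ ball (0 : ℂ) 1 := by
    constructor <;> simp; norm_num
  have hm2 : ((0, 1 / 2) : ℂ × ℂ) ∈ ball (0 : ℂ) 1 ×ˢ ball (0 : ℂ) 1 := by
    constructor <;> simp; norm_num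
  have hn1 : ‖T (1 / 2, 0)‖ = 1 / 2 := by
    rw [le_antisymm (hTle _ hm1) (hTge _ hm1)]; simp [Prod.norm_def]
  have hn2 : ‖T (0, 1 / 2)‖ = 1 / 2 := by
    rw [le_antisymm (hTle _ hm2) (hTge _ hm2)]; simp [Prod.norm_def]
  rw [Prod.norm_def] at hn1 hn2
  rcases max_choice ‖(T (1 / 2, 0)).1‖ ‖(T (1 / 2, 0)).2‖ with h | h
  · obtain ⟨u, hu, hTu⟩ := exists_eq_mul_fst_of_norm_le hT1 hle1 (h ▸ hn1)
    rw [hTu _ hm2] at hn2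
    obtain ⟨v, hv, hTv⟩ := exists_eq_mul_snd_of_norm_le hT2 hle2 (by simpa using hn2)
    exact ⟨u, v, hu, hv, Or.inl fun z hz => Prod.ext (hTu z hz) (hTv z hz)⟩
  · obtain ⟨v, hv, hTv⟩ := exists_eq_mul_fst_of_norm_le hT2 hle2 (h ▸ hn1)
    rw [hTv _ hm2] at hn2
    obtain ⟨u, hu, hTu⟩ := exists_eq_mul_snd_of_norm_le hT1 hle1 (by simpa using hn2)
    exact ⟨u, v, hu, hv, Or.inr fun z hz => Prod.ext (hTu z hz) (hTv z hz)⟩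

/-- Automorphisms of the bidisc are given by Möbius transformations in each coordinate, up to a
permutation of the coordinates. -/
lemma IsAutOn.bidisc {F : ℂ × ℂ → ℂ × ℂ} (hF : IsAutOn (ball (0 : ℂ) 1 ×ˢ ball (0 : ℂ) 1) F) :
    ∃ u a v b : ℂ, ‖u‖ = 1 ∧ ‖a‖ < 1 ∧ ‖v‖ = 1 ∧ ‖b‖ < 1 ∧
      ((∀ z ∈ ball (0 : ℂ) 1 ×ˢ ball (0 : ℂ) 1,
          F z = (discMoebius u a z.1, discMoebius v b z.2)) ∨
        ∀ z ∈ ball (0 : ℂ) 1 ×ˢ ball (0 : ℂ) 1,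
          F z = (discMoebius u a z.2, discMoebius v b z.1)) := by
  obtain ⟨hFd, hFm, G, hGd, hGm, hGF, -⟩ := hF
  have hF0 := hFm (show (0 : ℂ × ℂ) ∈ ball (0 : ℂ) 1 ×ˢ ball (0 : ℂ) 1 by simp)
  set a := (F 0).1 with ha
  set b := (F 0).2 with hb
  have ha1 : ‖a‖ < 1 := by simpa using hF0.1
  have hb1 : ‖b‖ < 1 := by simpa using hF0.2
  have ha1' : ‖-a‖ < 1 := by simpa using ha1
  have hb1' : ‖-b‖ < 1 := by simpa using hb1
  have hone : ‖(1 : ℂ)‖ = 1 := norm_one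
  have hMm : ∀ {a b : ℂ}, ‖a‖ < 1 → ‖b‖ < 1 →
      MapsTo (fun z : ℂ × ℂ => (discMoebius 1 a z.1, discMoebius 1 b z.2))
        (ball (0 : ℂ) 1 ×ˢ ball (0 : ℂ) 1) (ball (0 : ℂ) 1 ×ˢ ball (0 : ℂ) 1) :=
    fun ha hb z hz => ⟨discMoebius_mapsTo hone ha hz.1, discMoebius_mapsTo hone hb hz.2⟩
  have hMd : ∀ {a b : ℂ}, ‖a‖ < 1 → ‖b‖ < 1 →
      DifferentiableOn ℂ (fun z : ℂ × ℂ => (discMoebius 1 a z.1, discMoebius 1 b z.2))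
        (ball (0 : ℂ) 1 ×ˢ ball (0 : ℂ) 1) := fun ha hb =>
    ((discMoebius_differentiableOn hone ha).comp differentiableOn_fst fun z hz => hz.1).prodMk
      ((discMoebius_differentiableOn hone hb).comp differentiableOn_snd fun z hz => hz.2)
  have hinv : ∀ z ∈ ball (0 : ℂ) 1 ×ˢ ball (0 : ℂ) 1,
      (discMoebius 1 a (discMoebius 1 (-a) z.1), discMoebius 1 b (discMoebius 1 (-b) z.2)) = z := by
    intro z hz
    have h1 := discMoebius_neg_comp ha1' (mem_ball_zero_iff.1 hz.1)
    have h2 := discMoebius_neg_comp hb1' (mem_ball_zero_iff.1 hz.2)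
    rw [neg_neg] at h1 h2
    rw [h1, h2]
  obtain ⟨u, v, hu, hv, h⟩ := bidisc_aut_fixing_zero ((hMd ha1' hb1').comp hFd hFm)
    ((hMm ha1' hb1').comp hFm) (hGd.comp (hMd ha1 hb1) (hMm ha1 hb1)) (hGm.comp (hMm ha1 hb1))
    (fun z hz => by
      simp only [Function.comp]
      rw [hinv (F z) (hFm hz)]
      exact hGF hz)
    (by simp [discMoebius, ← ha, ← hb])
  have hrot : ∀ u a z : ℂ, discMoebius 1 a (u * z) = discMoebius u a z := fun u a z => by
    simp [discMoebius, mul_assoc]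
  refine ⟨u, a, v, b, hu, ha1, hv, hb1, h.imp (fun h z hz => ?_) (fun h z hz => ?_)⟩
  all_goals
    have h1 := hinv (F z) (hFm hz)
    have h2 := h z hz
    simp only [Function.comp, Prod.mk.injEq] at h2
    rw [h2.1, h2.2, hrot, hrot] at h1
    exact h1.symm

/-- A disc automorphism without fixed points in the open disc has a fixed point on the circle. -/
lemma exists_norm_eq_one_fixed {u a : ℂ} (hu : ‖u‖ = 1) (ha : ‖a‖ < 1)
    (hfix : ∀ z ∈ ball (0 : ℂ) 1, discMoebius u a z ≠ z) :
    ∃ p : ℂ, ‖p‖ = 1 ∧ u * p + a = p * (1 + star a * u * p) := by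
  have hu0 : u ≠ 0 := by rintro rfl; simp at hu
  have hno : ∀ z : ℂ, u * z + a = z * (1 + star a * u * z) → 1 ≤ ‖z‖ := by
    intro z hz
    by_contra! h
    refine hfix z (by simpa using h) ?_
    rw [discMoebius, div_eq_iff (discMoebius_denom_ne_zero hu ha h), hz]
  have ha0 : a ≠ 0 := by
    rintro rfl
    have := hno 0 (by simp)
    simp at this
    linarith
  have hsa : star a ≠ 0 := by simpa using ha0
  obtain ⟨p, hp⟩ := exists_quadratic_eq_zero (K := ℂ) (a := star a * u) (b := 1 - u)
    (c := -a) (mul_ne_zero hsa hu0) (by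
      obtain ⟨s, hs⟩ := IsAlgClosed.exists_pow_nat_eq (discrim (star a * u) (1 - u) (-a)) two_pos
      exact ⟨s, by rw [← hs, sq]⟩)
  have hp1 : u * p + a = p * (1 + star a * u * p) := by linear_combination -hp
  have hp0 : p ≠ 0 := by rintro rfl; simp [ha0] at hp
  have hle := hno p hp1
  have hle' := hno (-a / (star a * u * p)) (by field_simp; linear_combination hp)
  refine ⟨p, le_antisymm ?_ hle, hp1⟩
  have : ‖-a / (star a * u * p)‖ = 1 / ‖p‖ := by
    have : ‖a‖ ≠ 0 := by simpa using ha0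
    rw [norm_div, norm_mul, norm_mul, norm_neg, norm_star, hu]
    field_simp
  rw [this, le_div_iff₀ (by positivity)] at hle'
  linarith

/-- The Cayley transform from the unit disc to the upper half-plane, sending `p` to `∞`. -/
def cayley (p z : ℂ) : ℂ := Complex.I * (p + z) / (p - z)

/-- The inverse of the Cayley transform. -/
def cayleyInv (p ζ : ℂ) : ℂ := p * (ζ - Complex.I) / (ζ + Complex.I)

lemma sub_ne_zero_of_norm_lt {p z : ℂ} (hp : ‖p‖ = 1) (hz : ‖z‖ < 1) : p - z ≠ 0 := by
  rw [sub_ne_zero]; rintro rfl; linarith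

lemma add_I_ne_zero {ζ : ℂ} (hζ : 0 ≤ ζ.im) : ζ + Complex.I ≠ 0 := by
  intro h
  have := congrArg Complex.im h
  simp at this
  linarith

lemma cayley_im_pos {p z : ℂ} (hp : ‖p‖ = 1) (hz : ‖z‖ < 1) : 0 < (cayley p z).im := by
  have hne := sub_ne_zero_of_norm_lt hp hz
  have h1 : Complex.normSq p = 1 := by rw [Complex.normSq_eq_norm_sq, hp]; norm_num
  have h2 : Complex.normSq z < 1 := by
    rw [Complex.normSq_eq_norm_sq]; nlinarith [norm_nonneg z]
  have : (cayley p z).im = (1 - Complex.normSq z) / Complex.normSq (p - z) := by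
    rw [cayley, mul_div_assoc, Complex.I_mul_im, Complex.div_re, ← add_div]
    congr 1
    rw [← h1]
    simp [Complex.normSq_apply]
    ring
  rw [this]
  exact div_pos (by linarith) (Complex.normSq_pos.2 hne)

lemma norm_cayleyInv_lt_one {p ζ : ℂ} (hp : ‖p‖ = 1) (hζ : 0 < ζ.im) : ‖cayleyInv p ζ‖ < 1 := by
  have hne := add_I_ne_zero hζ.le
  rw [cayleyInv, norm_div, norm_mul, hp, one_mul, div_lt_one (norm_pos_iff.2 hne)]
  refine lt_of_pow_lt_pow_left₀ 2 (norm_nonneg _) ?_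
  simp only [← Complex.normSq_eq_norm_sq, Complex.normSq_apply]
  simp
  nlinarith

lemma norm_cayleyInv_ofReal {p : ℂ} (hp : ‖p‖ = 1) (x : ℝ) : ‖cayleyInv p x‖ = 1 := by
  have hne : (x : ℂ) + Complex.I ≠ 0 := add_I_ne_zero (by simp)
  have : ‖(x : ℂ) - Complex.I‖ = ‖(x : ℂ) + Complex.I‖ := by
    rw [← Complex.norm_conj ((x : ℂ) + Complex.I)]
    simp [sub_eq_add_neg]
  rw [cayleyInv, norm_div, norm_mul, hp, one_mul, this, div_self (norm_ne_zero_iff.2 hne)]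

lemma cayleyInv_cayley {p z : ℂ} (hp : ‖p‖ = 1) (hz : ‖z‖ < 1) :
    cayleyInv p (cayley p z) = z := by
  have hne := sub_ne_zero_of_norm_lt hp hz
  have hp0 : p ≠ 0 := by rintro rfl; simp at hp
  have h1 := add_I_ne_zero (cayley_im_pos hp hz).le
  rw [cayleyInv, div_eq_iff h1]
  have hc : cayley p z * (p - z) = Complex.I * (p + z) := div_mul_cancel₀ _ hne
  linear_combination hc

lemma continuousOn_cayleyInv (p : ℂ) : ContinuousOn (cayleyInv p) {ζ | 0 < ζ.im} := by
  unfold cayleyInv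
  exact ContinuousOn.div (by fun_prop) (by fun_prop) fun ζ hζ => add_I_ne_zero (le_of_lt hζ)

lemma differentiableOn_cayley {p : ℂ} (hp : ‖p‖ = 1) :
    DifferentiableOn ℂ (cayley p) (ball 0 1) := by
  unfold cayley
  exact DifferentiableOn.div (by fun_prop) (by fun_prop) fun z hz =>
    sub_ne_zero_of_norm_lt hp (mem_ball_zero_iff.1 hz)

/-- In the half-plane model with the fixed point at `∞`, a disc automorphism is a real affine
map. -/
lemma cayley_discMoebius {u a p : ℂ} (hu : ‖u‖ = 1) (ha : ‖a‖ < 1) (hp : ‖p‖ = 1)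
    (hfix : u * p + a = p * (1 + star a * u * p)) :
    ∃ A b : ℝ, 0 < A ∧
      ∀ z ∈ ball (0 : ℂ) 1, cayley p (discMoebius u a z) = A * cayley p z + b := by
  have hpq : p * star p = 1 := by
    have := Complex.mul_conj p
    rw [Complex.normSq_eq_norm_sq, hp] at this
    simpa using this
  set d : ℂ := 1 - star a * p with hd
  have he : star d = 1 - a * star p := by simp [hd]
  have hd0 : d ≠ 0 := by
    intro h
    have h1 : star a * p = 1 := by linear_combination -h
    have h2 := congrArg norm h1
    simp [hp] at h2
    linarith
  have he0 : star d ≠ 0 := by simpa using hd0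
  have hdd : d * star d = (Complex.normSq d : ℂ) := Complex.mul_conj d
  have haa : a * star a = (Complex.normSq a : ℂ) := Complex.mul_conj a
  have hdi : Complex.I * (d - star d) = ((-2 * d.im : ℝ) : ℂ) := by
    have := Complex.sub_conj d
    rw [starRingEnd_apply] at this
    rw [this]
    push_cast
    linear_combination (2 * (d.im : ℂ)) * Complex.I_mul_I
  have hupd : u * p * d = p - a := by rw [hd]; linear_combination hfix
  have hud : u * d = star d := by
    rw [he]; linear_combination star p * hupd + (1 - u * d) * hpq
  have haq : a = p * (1 - star d) := by rw [he]; linear_combination -a * hpq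
  have haq' : star a = (1 - d) * star p := by rw [hd]; linear_combination -star a * hpq
  refine ⟨(1 - Complex.normSq a) / Complex.normSq d, -2 * d.im / Complex.normSq d, ?_, ?_⟩
  · refine div_pos ?_ (Complex.normSq_pos.2 hd0)
    rw [Complex.normSq_eq_norm_sq]
    nlinarith [norm_nonneg a]
  · intro z hz
    have hz1 : ‖z‖ < 1 := mem_ball_zero_iff.1 hz
    have hden := discMoebius_denom_ne_zero hu ha hz1
    have hw1 := norm_discMoebius_lt_one hu ha hz1
    have hw : discMoebius u a z * (1 + star a * u * z) = u * z + a := div_mul_cancel₀ _ hden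
    set w := discMoebius u a z
    have hwz := sub_ne_zero_of_norm_lt hp hw1
    have hpz := sub_ne_zero_of_norm_lt hp hz1
    have hA : (((1 - Complex.normSq a) / Complex.normSq d : ℝ) : ℂ) =
        (d + star d - d * star d) / (d * star d) := by
      push_cast
      rw [← hdd, ← haa]
      congr 1
      rw [haq', haq]
      linear_combination -(1 - star d) * (1 - d) * hpq
    have hB : ((-2 * d.im / Complex.normSq d : ℝ) : ℂ) =
        Complex.I * (d - star d) / (d * star d) := by
      rw [hdi, hdd]; push_cast; rfl
    have hw' : w * (d + star a * star d * z) = star d * z + a * d := by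
      rw [← hud]; linear_combination d * hw
    have hDe : d + star a * star d * z ≠ 0 := by
      have : d + star a * star d * z = d * (1 + star a * u * z) := by rw [← hud]; ring
      rw [this]; exact mul_ne_zero hd0 hden
    have h1 : (p + w) * (d + star a * star d * z) =
        p * (2 * d - d * star d) + z * (2 * star d - d * star d) := by
      rw [haq'] at hw' ⊢
      rw [haq] at hw'
      linear_combination hw' + (1 - d) * star d * z * hpq
    have h2 : (p - w) * (d + star a * star d * z) = d * star d * (p - z) := by
      rw [haq'] at hw' ⊢
      rw [haq] at hw'
      linear_combination -hw' + (1 - d) * star d * z * hpq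
    rw [hA, hB, cayley, cayley, ← mul_div_mul_right _ _ hDe, mul_assoc, h1, h2]
    field_simp
    ring

/-- The maps `h` and `g` identify the disc with a horizontal strip or half-plane
`{ζ | ζ.im ∈ I}` in such a way that `φ` becomes the translation by `1`; the points `p₁`, `p₂` of
the unit circle correspond to infinity. -/
structure TranslationModel (φ h g : ℂ → ℂ) (I : Set ℝ) (p₁ p₂ : ℂ) : Prop where
  ordConnected : I.OrdConnected
  differentiableOn : DifferentiableOn ℂ h (ball 0 1)
  mapsTo : MapsTo h (ball 0 1) (Complex.im ⁻¹' I)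
  continuousOn_inv : ContinuousOn g (Complex.im ⁻¹' I)
  mapsTo_inv : MapsTo g (Complex.im ⁻¹' I) (ball 0 1)
  left_inv : ∀ z ∈ ball (0 : ℂ) 1, g (h z) = z
  map_eq : ∀ z ∈ ball (0 : ℂ) 1, h (φ z) = h z + 1
  norm_left : ‖p₁‖ = 1
  norm_right : ‖p₂‖ = 1
  at_infinity : ∀ ε > 0, ∃ M : ℝ, ∀ z ∈ ball (0 : ℂ) 1, M < ‖h z‖ → ‖z - p₁‖ * ‖z - p₂‖ < ε

lemma norm_sub_le_two {p z : ℂ} (hp : ‖p‖ = 1) (hz : ‖z‖ < 1) : ‖z - p‖ ≤ 2 :=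
  (norm_sub_le _ _).trans (by linarith)

lemma TranslationModel.of_parabolic {φ : ℂ → ℂ} {p : ℂ} (hp : ‖p‖ = 1) {b : ℝ} (hb : b ≠ 0)
    (h : ∀ z ∈ ball (0 : ℂ) 1, cayley p (φ z) = cayley p z + b) :
    TranslationModel φ (fun z => cayley p z / b) (fun ζ => cayleyInv p (b * ζ)) {y | 0 < b * y}
      p p := by
  have hb' : (b : ℂ) ≠ 0 := by exact_mod_cast hb
  refine ⟨⟨fun x hx y hy t ht => ?_⟩, (differentiableOn_cayley hp).div_const _, fun z hz => ?_, ?_,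
    fun ζ hζ => ?_, fun z hz => ?_, fun z hz => ?_, hp, hp, fun ε hε => ?_⟩
  · simp only [mem_ofPred_eq] at *
    rcases hb.lt_or_gt with hb | hb <;> nlinarith [ht.1, ht.2]
  · have := cayley_im_pos hp (mem_ball_zero_iff.1 hz)
    simp only [mem_preimage, mem_ofPred_eq, Complex.div_ofReal_im]
    field_simp
    exact this
  · exact (continuousOn_cayleyInv p).comp (by fun_prop) fun ζ hζ => by simpa using hζ
  · rw [mem_ball_zero_iff]
    exact norm_cayleyInv_lt_one hp (by simpa using hζ)
  · simp only [mul_div_cancel₀ _ hb']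
    exact cayleyInv_cayley hp (mem_ball_zero_iff.1 hz)
  · simp only [h z hz]
    field_simp
  · refine ⟨4 / (|b| * ε), fun z hz hM => ?_⟩
    have hz1 := mem_ball_zero_iff.1 hz
    have h1 := norm_sub_le_two hp hz1
    have hpz : 0 < ‖z - p‖ := by
      rw [norm_sub_rev]; exact norm_pos_iff.2 (sub_ne_zero_of_norm_lt hp hz1)
    have hbpos : 0 < |b| := abs_pos.2 hb
    have h2 : ‖p + z‖ ≤ 2 := (norm_add_le _ _).trans (by linarith)
    rw [cayley, norm_div, norm_div, norm_mul, Complex.norm_I, one_mul, norm_sub_rev p z,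
      Complex.norm_real, Real.norm_eq_abs, div_div, div_lt_div_iff₀ (by positivity)
      (by positivity)] at hM
    have h3 : 4 * ‖z - p‖ < 2 * ε := by
      have : |b| * (4 * ‖z - p‖) < |b| * (2 * ε) := by nlinarith [mul_pos hbpos hε]
      exact lt_of_mul_lt_mul_left this hbpos.le
    nlinarith

lemma TranslationModel.of_hyperbolic {φ : ℂ → ℂ} {p : ℂ} (hp : ‖p‖ = 1) {A x : ℝ} (hA : 0 < A)
    (hA1 : A ≠ 1)
    (h : ∀ z ∈ ball (0 : ℂ) 1, cayley p (φ z) - x = A * (cayley p z - x)) :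
    TranslationModel φ (fun z => Complex.log (cayley p z - x) / Real.log A)
      (fun ζ => cayleyInv p (x + Complex.exp (Real.log A * ζ)))
      {y | 0 < Real.log A * y ∧ Real.log A * y < Real.pi} p (cayleyInv p x) := by
  set L := Real.log A with hL
  have hL0 : L ≠ 0 := Real.log_ne_zero_of_pos_of_ne_one hA hA1
  have hL0' : (L : ℂ) ≠ 0 := by exact_mod_cast hL0
  have him : ∀ z ∈ ball (0 : ℂ) 1, 0 < (cayley p z - x).im := fun z hz => by
    simpa using cayley_im_pos hp (mem_ball_zero_iff.1 hz)
  have hne : ∀ z ∈ ball (0 : ℂ) 1, cayley p z - x ≠ 0 := fun z hz h0 => by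
    have := him z hz
    simp [h0] at this
  have hexp : ∀ ζ : ℂ, ζ.im ∈ {y | 0 < L * y ∧ L * y < Real.pi} →
      0 < (x + Complex.exp (L * ζ)).im := fun ζ hζ => by
    simp only [Complex.add_im, Complex.ofReal_im, zero_add, Complex.exp_im, Complex.mul_im,
      Complex.ofReal_re, zero_mul, add_zero]
    exact mul_pos (Real.exp_pos _) (Real.sin_pos_of_pos_of_lt_pi hζ.1 hζ.2)
  refine ⟨⟨fun y hy y' hy' t ht => ?_⟩, ?_, fun z hz => ?_, ?_,
    fun ζ hζ => ?_, fun z hz => ?_, fun z hz => ?_, hp, norm_cayleyInv_ofReal hp x, fun ε hε => ?_⟩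
  · simp only [mem_ofPred_eq] at *
    rcases hL0.lt_or_gt with hb | hb <;> constructor <;> nlinarith [ht.1, ht.2]
  · refine DifferentiableOn.div_const (DifferentiableOn.clog
      ((differentiableOn_cayley hp).sub_const _) fun z hz => ?_) _
    exact Or.inr (him z hz).ne'
  · have := him z hz
    simp only [mem_preimage, mem_ofPred_eq, Complex.div_ofReal_im, Complex.log_im,
      mul_div_cancel₀ _ hL0]
    refine ⟨lt_of_le_of_ne (Complex.arg_nonneg_iff.2 this.le) fun h0 => ?_,
      lt_of_le_of_ne (Complex.arg_le_pi _) fun h0 => ?_⟩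
    · exact this.ne' (Complex.arg_eq_zero_iff.1 h0.symm).2
    · exact this.ne' (Complex.arg_eq_pi_iff.1 h0).2
  · exact (continuousOn_cayleyInv p).comp (by fun_prop) fun ζ hζ => hexp ζ hζ
  · rw [mem_ball_zero_iff]
    exact norm_cayleyInv_lt_one hp (hexp ζ hζ)
  · simp only [mul_div_cancel₀ _ hL0', Complex.exp_log (hne z hz), add_sub_cancel]
    exact cayleyInv_cayley hp (mem_ball_zero_iff.1 hz)
  · simp only [h z hz]
    rw [Complex.log_ofReal_mul hA (hne z hz), add_div, div_self hL0', add_comm]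
  · set p₂ := cayleyInv p x with hp₂
    set κ : ℝ := ‖p - p₂‖ / 2 with hκ
    have hxI : (x : ℂ) + Complex.I ≠ 0 := add_I_ne_zero (by simp)
    have hp0 : p ≠ 0 := by rintro rfl; simp at hp
    have hpp : p - p₂ = 2 * Complex.I * p / (x + Complex.I) := by
      rw [hp₂, cayleyInv]; field_simp; ring
    have hκ0 : 0 < κ := by
      refine div_pos (norm_pos_iff.2 ?_) two_pos
      rw [hpp]
      exact div_ne_zero (mul_ne_zero (by simp) hp0) hxI
    set T : ℝ := -Real.log (ε / (4 * (κ + κ⁻¹))) with hT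
    have hc : 0 < 4 * (κ + κ⁻¹) := by positivity
    have hexpT : Real.exp (-T) = ε / (4 * (κ + κ⁻¹)) := by
      rw [hT, neg_neg, Real.exp_log (by positivity)]
    refine ⟨(T + Real.pi) / |L|, fun z hz hM => ?_⟩
    have hz1 := mem_ball_zero_iff.1 hz
    have hpz := sub_ne_zero_of_norm_lt hp hz1
    have h1 := norm_sub_le_two hp hz1
    have h2 := norm_sub_le_two (norm_cayleyInv_ofReal hp x) hz1
    have hζ0 := norm_pos_iff.2 (hne z hz)
    have hid : (cayley p z - x) * (p - z) * (p - p₂) = 2 * Complex.I * p * (z - p₂) := by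
      rw [hpp, hp₂, cayleyInv, cayley]
      field_simp
      ring
    have hid' : ‖cayley p z - x‖ * ‖z - p‖ * κ = ‖z - p₂‖ := by
      have := congrArg norm hid
      simp only [norm_mul, hp, Complex.norm_I, Complex.norm_ofNat, norm_sub_rev p z] at this
      rw [hκ]; linarith
    rw [norm_div, Complex.norm_real, Real.norm_eq_abs,
      div_lt_div_iff_of_pos_right (abs_pos.2 hL0)] at hM
    have hlog : ‖Complex.log (cayley p z - x)‖ ≤
        |Real.log ‖cayley p z - x‖| + Real.pi := by
      refine (Complex.norm_le_abs_re_add_abs_im _).trans ?_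
      rw [Complex.log_re, Complex.log_im]
      gcongr
      exact Complex.abs_arg_le_pi _
    have hTlog : T < |Real.log ‖cayley p z - x‖| := by linarith
    have hfin : ∀ s : ℝ, 0 < s → s < Real.exp (-T) →
        ‖z - p‖ * ‖z - p₂‖ ≤ 4 * (κ + κ⁻¹) * s → ‖z - p‖ * ‖z - p₂‖ < ε := by
      intro s hs hsT hle
      rw [hexpT, lt_div_iff₀ hc] at hsT
      linarith
    rcases lt_abs.1 hTlog with hbig | hsmall
    · have h3 : ‖cayley p z - x‖⁻¹ < Real.exp (-T) := by
        rw [← Real.log_lt_iff_lt_exp (by positivity), Real.log_inv]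
        linarith
      refine hfin _ (by positivity) h3 ?_
      have h4 : ‖z - p‖ = κ⁻¹ * ‖cayley p z - x‖⁻¹ * ‖z - p₂‖ := by
        rw [← hid']; field_simp
      have h5 : ‖z - p‖ ≤ κ⁻¹ * ‖cayley p z - x‖⁻¹ * 2 := by
        rw [h4]; gcongr
      calc ‖z - p‖ * ‖z - p₂‖ ≤ (κ⁻¹ * ‖cayley p z - x‖⁻¹ * 2) * 2 := by gcongr
        _ = 4 * κ⁻¹ * ‖cayley p z - x‖⁻¹ := by ring
        _ ≤ _ := by gcongr; linarith
    · have h3 : ‖cayley p z - x‖ < Real.exp (-T) := by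
        rw [← Real.log_lt_iff_lt_exp (by positivity)]
        linarith
      refine hfin _ hζ0 h3 ?_
      calc ‖z - p‖ * ‖z - p₂‖ = ‖z - p‖ * (‖cayley p z - x‖ * ‖z - p‖ * κ) := by rw [hid']
        _ ≤ 2 * (‖cayley p z - x‖ * 2 * κ) := by gcongr
        _ = 4 * κ * ‖cayley p z - x‖ := by ring
        _ ≤ _ := by gcongr; linarith [inv_pos.2 hκ0]

/-- A disc automorphism without fixed points is conjugate to a translation of a horizontal strip
or half-plane. -/
lemma exists_translationModel {u a : ℂ} (hu : ‖u‖ = 1) (ha : ‖a‖ < 1)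
    (hfix : ∀ z ∈ ball (0 : ℂ) 1, discMoebius u a z ≠ z) :
    ∃ h g I p₁ p₂, TranslationModel (discMoebius u a) h g I p₁ p₂ := by
  obtain ⟨p, hp, hpfix⟩ := exists_norm_eq_one_fixed hu ha hfix
  obtain ⟨A, b, hA, hAb⟩ := cayley_discMoebius hu ha hp hpfix
  by_cases hA1 : A = 1
  · subst hA1
    have hAb' : ∀ z ∈ ball (0 : ℂ) 1, cayley p (discMoebius u a z) = cayley p z + b :=
      fun z hz => by simpa using hAb z hz
    refine ⟨_, _, _, _, _, TranslationModel.of_parabolic hp ?_ hAb'⟩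
    rintro rfl
    have h0 : (0 : ℂ) ∈ ball (0 : ℂ) 1 := by simp
    have h1 := hAb' 0 h0
    apply hfix 0 h0
    rw [← cayleyInv_cayley hp (mem_ball_zero_iff.1 (discMoebius_mapsTo hu ha h0)), h1]
    simpa using cayleyInv_cayley hp (z := 0) (by simp)
  · have hA1' : (1 - A : ℂ) ≠ 0 := by
      rw [sub_ne_zero]; exact_mod_cast Ne.symm hA1
    refine ⟨_, _, _, _, _, TranslationModel.of_hyperbolic hp (x := b / (1 - A)) hA hA1
      fun z hz => ?_⟩
    rw [hAb z hz]
    push_cast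
    field_simp
    ring

/-- The maps `B` and `g` identify the disc with itself in such a way that `φ` becomes the
rotation by `u`. -/
structure RotationModel (φ B g : ℂ → ℂ) (u : ℂ) : Prop where
  norm_eq : ‖u‖ = 1
  differentiableOn : DifferentiableOn ℂ B (ball 0 1)
  mapsTo : MapsTo B (ball 0 1) (ball 0 1)
  continuousOn_inv : ContinuousOn g (ball 0 1)
  mapsTo_inv : MapsTo g (ball 0 1) (ball 0 1)
  left_inv : ∀ z ∈ ball (0 : ℂ) 1, g (B z) = z
  map_eq : ∀ z ∈ ball (0 : ℂ) 1, B (φ z) = u * B z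

/-- A disc automorphism with a fixed point is conjugate to a rotation. -/
lemma exists_rotationModel {u a c : ℂ} (hu : ‖u‖ = 1) (ha : ‖a‖ < 1) (hc : ‖c‖ < 1)
    (hfix : discMoebius u a c = c) :
    ∃ B g v, RotationModel (discMoebius u a) B g v := by
  have hone : ‖(1 : ℂ)‖ = 1 := norm_one
  have hc' : ‖-c‖ < 1 := by simpa using hc
  have huu : u * star u = 1 := by
    have := Complex.mul_conj u
    rw [Complex.normSq_eq_norm_sq, hu] at this
    simpa using this
  have hdc := discMoebius_denom_ne_zero hu ha hc
  have hsdc : star (1 + star a * u * c) ≠ 0 := star_ne_zero.2 hdc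
  refine ⟨discMoebius 1 (-c), discMoebius 1 c, u * star (1 + star a * u * c) / (1 + star a * u * c),
    ?_, discMoebius_differentiableOn hone hc', discMoebius_mapsTo hone hc',
    (discMoebius_differentiableOn hone hc).continuousOn, discMoebius_mapsTo hone hc,
    fun z hz => ?_, fun z hz => ?_⟩
  · rw [norm_div, norm_mul, hu, norm_star, one_mul, div_self (norm_ne_zero_iff.2 hdc)]
  · simpa using discMoebius_neg_comp hc' (mem_ball_zero_iff.1 hz)
  · have hz1 := mem_ball_zero_iff.1 hz
    have hdz := discMoebius_denom_ne_zero hu ha hz1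
    have hw : discMoebius u a z * (1 + star a * u * z) = u * z + a := div_mul_cancel₀ _ hdz
    have hcc : c * (1 + star a * u * c) = u * c + a := by
      rwa [discMoebius, div_eq_iff hdc, eq_comm] at hfix
    have hss : star c * star (1 + star a * u * c) = star u * star c + star a := by
      rw [← star_mul', hcc]; simp
    have hE : star (1 + star a * u * c) = 1 + a * star u * star c := by simp
    have hsz := discMoebius_denom_ne_zero hone hc' hz1
    have hsw := discMoebius_denom_ne_zero hone hc' (norm_discMoebius_lt_one hu ha hz1)
    set w := discMoebius u a z
    have h1 : (w - c) * ((1 + star a * u * z) * (1 + star a * u * c)) =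
        u * (1 - a * star a) * (z - c) := by
      linear_combination (1 + star a * u * c) * hw - (1 + star a * u * z) * hcc
    have h2 : (1 - star c * w) * ((1 + star a * u * z) * star (1 + star a * u * c)) =
        (1 - a * star a) * (1 - star c * z) := by
      rw [hE] at hss ⊢
      linear_combination (-(star c * (1 + a * star u * star c))) * hw - (u * z + a) * hss +
        (a * star a * star c * z - star c * z) * huu
    rw [discMoebius, discMoebius, div_mul_div_comm, div_eq_div_iff hsw (mul_ne_zero hdc hsz)]
    apply mul_right_cancel₀ hdz
    rw [star_neg]
    linear_combination (1 - star c * z) * h1 - u * (z - c) * h2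

/-- `f` is holomorphic on `Ω` and invariant under `γ`. -/
def IsInvHolOn (Ω : Set E) (γ : E → E) (f : E → ℂ) : Prop :=
  DifferentiableOn ℂ f Ω ∧ ∀ x ∈ Ω, f (γ x) = f x

/-- `z` lies in the hull of `K` with respect to the `γ`-invariant holomorphic functions. -/
def MemInvHull (Ω : Set E) (γ : E → E) (K : Set E) (z : E) : Prop :=
  ∀ f, IsInvHolOn Ω γ f → ∀ R : ℝ, 0 ≤ R → (∀ x ∈ K, ‖f x‖ ≤ R) → ‖f z‖ ≤ R

/-- The `γ`-invariant holomorphic functions on `Ω` separate the points that are not related by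
`r`, and the hull of a compact set is contained in the `r`-saturation of a compact set. -/
structure InvStein (Ω : Set E) (γ : E → E) (r : E → E → Prop) : Prop where
  separates : ∀ z ∈ Ω, ∀ w ∈ Ω, (∀ f, IsInvHolOn Ω γ f → f z = f w) → r z w
  convex : ∀ K ⊆ Ω, IsCompact K → ∃ L ⊆ Ω, IsCompact L ∧
    ∀ z ∈ Ω, MemInvHull Ω γ K z → ∃ y ∈ L, r z y

/-- `γ` and `γ'` are inverse to each other on `Ω`, and `r` contains the orbit equivalence relation
of `γ`. -/
structure IsOrbitRel {X : Type*} (Ω : Set X) (γ γ' : X → X) (r : X → X → Prop) : Prop where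
  mapsTo : MapsTo γ Ω Ω
  mapsTo_inv : MapsTo γ' Ω Ω
  left_inv : ∀ x ∈ Ω, γ' (γ x) = x
  right_inv : ∀ x ∈ Ω, γ (γ' x) = x
  refl : ∀ x ∈ Ω, r x x
  fwd : ∀ x ∈ Ω, ∀ y ∈ Ω, r x y → r x (γ y)
  bwd : ∀ x ∈ Ω, ∀ y ∈ Ω, r x y → r x (γ' y)

section InvStein

variable {Ω : Set E} {γ γ' : E → E} {r : E → E → Prop}

lemma IsOrbitRel.sq {X : Type*} {Ω : Set X} {γ γ' : X → X} {r : X → X → Prop}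
    (h : IsOrbitRel Ω γ γ' r) : IsOrbitRel Ω (γ ∘ γ) (γ' ∘ γ') r where
  mapsTo := h.mapsTo.comp h.mapsTo
  mapsTo_inv := h.mapsTo_inv.comp h.mapsTo_inv
  left_inv x hx := by simp [h.left_inv _ (h.mapsTo hx), h.left_inv x hx]
  right_inv x hx := by simp [h.right_inv _ (h.mapsTo_inv hx), h.right_inv x hx]
  refl := h.refl
  fwd x hx y hy hr := h.fwd x hx _ (h.mapsTo hy) (h.fwd x hx y hy hr)
  bwd x hx y hy hr := h.bwd x hx _ (h.mapsTo_inv hy) (h.bwd x hx y hy hr)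

lemma IsOrbitRel.exists_zpow {X : Type*} {Ω : Set X} {γ γ' : X → X} {r : X → X → Prop}
    (h : IsOrbitRel Ω γ γ' r) {P : ℤ → X → Prop}
    (hfwd : ∀ k, ∀ y ∈ Ω, P k y → P (k + 1) (γ y)) (hbwd : ∀ k, ∀ y ∈ Ω, P k y → P (k - 1) (γ' y))
    {x : X} (hx : x ∈ Ω) (h0 : P 0 x) (k : ℤ) : ∃ y ∈ Ω, r x y ∧ P k y := by
  induction k using Int.induction_on with
  | zero => exact ⟨x, hx, h.refl x hx, h0⟩
  | succ n ih =>
    obtain ⟨y, hy, hr, hP⟩ := ih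
    exact ⟨γ y, h.mapsTo hy, h.fwd x hx y hy hr, hfwd _ y hy hP⟩
  | pred n ih =>
    obtain ⟨y, hy, hr, hP⟩ := ih
    exact ⟨γ' y, h.mapsTo_inv hy, h.bwd x hx y hy hr, hbwd _ y hy hP⟩

lemma isInvHolOn_exp {H : E → ℂ} (hH : DifferentiableOn ℂ H Ω)
    (hγ : ∀ x ∈ Ω, H (γ x) = H x + 1) :
    IsInvHolOn Ω γ fun x => Complex.exp (2 * Real.pi * Complex.I * H x) := by
  refine ⟨(hH.const_mul _).cexp, fun x hx => ?_⟩
  beta_reduce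
  rw [hγ x hx, mul_add, mul_one, Complex.exp_add, Complex.exp_two_pi_mul_I, mul_one]

lemma isInvHolOn_exp_neg {H : E → ℂ} (hH : DifferentiableOn ℂ H Ω)
    (hγ : ∀ x ∈ Ω, H (γ x) = H x + 1) :
    IsInvHolOn Ω γ fun x => Complex.exp (-(2 * Real.pi * Complex.I * H x)) := by
  refine ⟨(hH.const_mul _).neg.cexp, fun x hx => ?_⟩
  beta_reduce
  rw [hγ x hx, mul_add, mul_one, neg_add, Complex.exp_add, Complex.exp_neg (2 * _ * _),
    Complex.exp_two_pi_mul_I, inv_one, mul_one]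

lemma norm_exp_two_pi_I_mul (ζ : ℂ) :
    ‖Complex.exp (2 * Real.pi * Complex.I * ζ)‖ = Real.exp (-(2 * Real.pi * ζ.im)) := by
  rw [Complex.norm_exp]; congr 1; simp

lemma norm_exp_neg_two_pi_I_mul (ζ : ℂ) :
    ‖Complex.exp (-(2 * Real.pi * Complex.I * ζ))‖ = Real.exp (2 * Real.pi * ζ.im) := by
  rw [Complex.norm_exp]; congr 1; simp

lemma MemInvHull.im_mem_Icc {H : E → ℂ} (hH : DifferentiableOn ℂ H Ω)
    (hγ : ∀ x ∈ Ω, H (γ x) = H x + 1) {K : Set E} {z : E} (hz : MemInvHull Ω γ K z) {α β : ℝ}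
    (hK : ∀ x ∈ K, (H x).im ∈ Icc α β) : (H z).im ∈ Icc α β := by
  have h2 : 0 < 2 * Real.pi := by positivity
  have h := hz _ (isInvHolOn_exp hH hγ) (Real.exp (-(2 * Real.pi * α))) (Real.exp_pos _).le
    fun x hx => by
      rw [norm_exp_two_pi_I_mul, Real.exp_le_exp, neg_le_neg_iff]
      exact mul_le_mul_of_nonneg_left (hK x hx).1 h2.le
  have h' := hz _ (isInvHolOn_exp_neg hH hγ) (Real.exp (2 * Real.pi * β)) (Real.exp_pos _).le
    fun x hx => by
      rw [norm_exp_neg_two_pi_I_mul, Real.exp_le_exp]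
      exact mul_le_mul_of_nonneg_left (hK x hx).2 h2.le
  rw [norm_exp_two_pi_I_mul, Real.exp_le_exp, neg_le_neg_iff] at h
  rw [norm_exp_neg_two_pi_I_mul, Real.exp_le_exp] at h'
  exact ⟨le_of_mul_le_mul_left h h2, le_of_mul_le_mul_left h' h2⟩

lemma not_memInvHull_empty (z : E) : ¬ MemInvHull Ω γ ∅ z := fun h => by
  have := h (fun _ => 1) ⟨differentiableOn_const _, fun _ _ => rfl⟩ 0 le_rfl (by simp)
  simp at this
  linarith

lemma exists_int_of_exp_eq {a b : ℂ}
    (h : Complex.exp (2 * Real.pi * Complex.I * a) = Complex.exp (2 * Real.pi * Complex.I * b)) :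
    ∃ k : ℤ, b = a + k := by
  obtain ⟨n, hn⟩ := Complex.exp_eq_exp_iff_exists_int.1 h.symm
  refine ⟨n, mul_left_cancel₀ Complex.two_pi_I_ne_zero ?_⟩
  linear_combination hn

lemma exists_im_mem_Icc {X : Type*} [TopologicalSpace X] {H : X → ℂ} {I : Set ℝ}
    (hI : I.OrdConnected) {K : Set X}
    (hK : IsCompact K) (hne : K.Nonempty) (hH : ContinuousOn H K)
    (hm : ∀ x ∈ K, (H x).im ∈ I) :
    ∃ α β, Icc α β ⊆ I ∧ ∀ x ∈ K, (H x).im ∈ Icc α β := by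
  have hc : ContinuousOn (fun x => (H x).im) K := Complex.continuous_im.comp_continuousOn hH
  obtain ⟨x₁, hx₁, h₁⟩ := hK.exists_isMinOn hne hc
  obtain ⟨x₂, hx₂, h₂⟩ := hK.exists_isMaxOn hne hc
  exact ⟨_, _, hI.out (hm x₁ hx₁) (hm x₂ hx₂), fun x hx => ⟨h₁ hx, h₂ hx⟩⟩

/-- If `γ` is a simultaneous translation of two horizontal strips or half-planes, the quotient is
Stein. -/
lemma InvStein.of_translation_translation (hr : IsOrbitRel Ω γ γ' r) {H₁ H₂ : E → ℂ}
    {G : ℂ × ℂ → E} {I₁ I₂ : Set ℝ} (hI₁ : I₁.OrdConnected) (hI₂ : I₂.OrdConnected)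
    (hd₁ : DifferentiableOn ℂ H₁ Ω) (hd₂ : DifferentiableOn ℂ H₂ Ω)
    (hm₁ : MapsTo H₁ Ω (Complex.im ⁻¹' I₁)) (hm₂ : MapsTo H₂ Ω (Complex.im ⁻¹' I₂))
    (hG : ContinuousOn G ((Complex.im ⁻¹' I₁) ×ˢ (Complex.im ⁻¹' I₂)))
    (hGm : MapsTo G ((Complex.im ⁻¹' I₁) ×ˢ (Complex.im ⁻¹' I₂)) Ω)
    (hGH : ∀ x ∈ Ω, G (H₁ x, H₂ x) = x)
    (hγ₁ : ∀ x ∈ Ω, H₁ (γ x) = H₁ x + 1) (hγ₂ : ∀ x ∈ Ω, H₂ (γ x) = H₂ x + 1) :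
    InvStein Ω γ r := by
  have hk : ∀ x ∈ Ω, ∀ k : ℤ, ∃ y ∈ Ω, r x y ∧ H₁ y = H₁ x + k ∧ H₂ y = H₂ x + k := by
    intro x hx k
    refine hr.exists_zpow (P := fun k y => H₁ y = H₁ x + k ∧ H₂ y = H₂ x + k) ?_ ?_ hx (by simp) k
    · rintro k y hy ⟨h1, h2⟩
      rw [hγ₁ y hy, hγ₂ y hy, h1, h2]
      push_cast
      constructor <;> ring
    · rintro k y hy ⟨h1, h2⟩
      have e1 := hγ₁ _ (hr.mapsTo_inv hy)
      have e2 := hγ₂ _ (hr.mapsTo_inv hy)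
      rw [hr.right_inv y hy] at e1 e2
      push_cast
      constructor
      · linear_combination h1 - e1
      · linear_combination h2 - e2
  have hdiff : IsInvHolOn Ω γ fun x => H₂ x - H₁ x :=
    ⟨hd₂.sub hd₁, fun x hx => by beta_reduce; rw [hγ₁ x hx, hγ₂ x hx]; ring⟩
  constructor
  · intro z hz w hw h
    obtain ⟨k, hkz⟩ := exists_int_of_exp_eq (h _ (isInvHolOn_exp hd₁ hγ₁))
    have h2 := h _ hdiff
    obtain ⟨y, hy, hry, e1, e2⟩ := hk z hz k
    have : y = w := by
      rw [← hGH y hy, ← hGH w hw, e1, e2, hkz]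
      congr 2
      linear_combination h2 - hkz
    exact this ▸ hry
  · intro K hKΩ hK
    rcases K.eq_empty_or_nonempty with rfl | hne
    · exact ⟨∅, empty_subset _, isCompact_empty, fun z _ h => (not_memInvHull_empty z h).elim⟩
    obtain ⟨α₁, β₁, hs₁, hb₁⟩ := exists_im_mem_Icc hI₁ hK hne (hd₁.continuousOn.mono hKΩ)
      fun x hx => hm₁ (hKΩ hx)
    obtain ⟨α₂, β₂, hs₂, hb₂⟩ := exists_im_mem_Icc hI₂ hK hne (hd₂.continuousOn.mono hKΩ)
      fun x hx => hm₂ (hKΩ hx)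
    obtain ⟨M, hM⟩ := hK.exists_bound_of_continuousOn (hdiff.1.continuousOn.mono hKΩ)
    have hM0 : 0 ≤ M := by
      obtain ⟨x, hx⟩ := hne
      exact (norm_nonneg _).trans (hM x hx)
    have hsub : (Icc 0 1 ×ℂ Icc α₁ β₁) ×ˢ (Icc (-(M + 1)) (M + 1) ×ℂ Icc α₂ β₂) ⊆
        (Complex.im ⁻¹' I₁) ×ˢ (Complex.im ⁻¹' I₂) := fun ζ hζ => ⟨hs₁ hζ.1.2, hs₂ hζ.2.2⟩
    refine ⟨G '' ((Icc 0 1 ×ℂ Icc α₁ β₁) ×ˢ (Icc (-(M + 1)) (M + 1) ×ℂ Icc α₂ β₂)),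
      (image_mono hsub).trans hGm.image_subset, ((isCompact_Icc.reProdIm isCompact_Icc).prod
        (isCompact_Icc.reProdIm isCompact_Icc)).image_of_continuousOn (hG.mono hsub), ?_⟩
    intro z hz hull
    obtain ⟨y, hy, hry, e1, e2⟩ := hk z hz (-⌊(H₁ z).re⌋)
    refine ⟨y, ⟨(H₁ y, H₂ y), ?_, hGH y hy⟩, hry⟩
    have i1 := hull.im_mem_Icc hd₁ hγ₁ hb₁
    have i2 := hull.im_mem_Icc hd₂ hγ₂ hb₂
    have hd := (Complex.abs_re_le_norm _).trans (hull _ hdiff M hM0 hM)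
    have hf := Int.fract_add_floor (H₁ z).re
    have hf0 := Int.fract_nonneg (H₁ z).re
    have hf1 := (Int.fract_lt_one (H₁ z).re).le
    rw [Complex.sub_re, abs_le] at hd
    rw [e1, e2]
    refine ⟨⟨?_, ?_⟩, ⟨?_, ?_⟩⟩
    · simp only [mem_preimage, Complex.add_re, Complex.neg_re, Complex.intCast_re, Int.cast_neg]
      constructor <;> linarith
    · simpa using i1
    · simp only [mem_preimage, Complex.add_re, Complex.neg_re, Complex.intCast_re, Int.cast_neg]
      constructor <;> linarith [hd.1, hd.2]
    · simpa using i2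

lemma le_of_forall_pow_le_mul_pow {x R C : ℝ} (hR : 0 ≤ R) (h : ∀ n : ℕ, x ^ n ≤ C * R ^ n) :
    x ≤ R := by
  by_contra! hlt
  rcases hR.eq_or_lt with rfl | hR
  · have := h 1
    simp at this
    linarith
  · obtain ⟨n, hn⟩ := pow_unbounded_of_one_lt C ((one_lt_div hR).2 hlt)
    rw [div_pow, lt_div_iff₀ (by positivity)] at hn
    exact absurd (h n) (not_le.2 hn)

/-- If `γ` is the product of a translation of a horizontal strip or half-plane and a rotation of
the disc, the quotient is Stein. -/
lemma InvStein.of_translation_rotation (hr : IsOrbitRel Ω γ γ' r) {H B : E → ℂ}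
    {G : ℂ × ℂ → E} {I : Set ℝ} {u : ℂ} (hu : ‖u‖ = 1) (hI : I.OrdConnected)
    (hdH : DifferentiableOn ℂ H Ω) (hdB : DifferentiableOn ℂ B Ω)
    (hmH : MapsTo H Ω (Complex.im ⁻¹' I)) (hmB : MapsTo B Ω (ball 0 1))
    (hG : ContinuousOn G ((Complex.im ⁻¹' I) ×ˢ ball 0 1))
    (hGm : MapsTo G ((Complex.im ⁻¹' I) ×ˢ ball 0 1) Ω)
    (hGH : ∀ x ∈ Ω, G (H x, B x) = x)
    (hγH : ∀ x ∈ Ω, H (γ x) = H x + 1) (hγB : ∀ x ∈ Ω, B (γ x) = u * B x) :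
    InvStein Ω γ r := by
  have hu0 : u ≠ 0 := by rintro rfl; simp at hu
  have hk : ∀ x ∈ Ω, ∀ k : ℤ, ∃ y ∈ Ω, r x y ∧ H y = H x + k ∧ B y = u ^ k * B x := by
    intro x hx k
    refine hr.exists_zpow (P := fun k y => H y = H x + k ∧ B y = u ^ k * B x) ?_ ?_ hx (by simp) k
    · rintro k y hy ⟨h1, h2⟩
      rw [hγH y hy, hγB y hy, h1, h2, zpow_add_one₀ hu0]
      push_cast
      constructor <;> ring
    · rintro k y hy ⟨h1, h2⟩
      have e1 := hγH _ (hr.mapsTo_inv hy)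
      have e2 := hγB _ (hr.mapsTo_inv hy)
      rw [hr.right_inv y hy] at e1 e2
      rw [zpow_sub_one₀ hu0]
      push_cast
      constructor
      · linear_combination h1 - e1
      · field_simp
        linear_combination h2 - e2
  set θ : ℕ → ℝ := fun n => Complex.arg (u ^ n) with hθ
  have hexpθ : ∀ n, Complex.exp (θ n * Complex.I) = u ^ n := fun n => by
    have := Complex.norm_mul_exp_arg_mul_I (u ^ n)
    rwa [norm_pow, hu, one_pow, Complex.ofReal_one, one_mul] at this
  have hinv : ∀ n : ℕ, IsInvHolOn Ω γ fun x => B x ^ n * Complex.exp (-(θ n * Complex.I) * H x) :=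
    fun n => ⟨(hdB.pow n).mul (hdH.const_mul _).cexp, fun x hx => by
      beta_reduce
      rw [hγB x hx, hγH x hx, mul_add, mul_one, Complex.exp_add, Complex.exp_neg (_ * _), hexpθ,
        mul_pow]
      field_simp⟩
  have hnorm : ∀ (n : ℕ) (ζ : ℂ), ‖Complex.exp (-(θ n * Complex.I) * ζ)‖ =
      Real.exp (θ n * ζ.im) := fun n ζ => by
    rw [Complex.norm_exp]; congr 1; simp
  constructor
  · intro z hz w hw h
    obtain ⟨k, hkz⟩ := exists_int_of_exp_eq (h _ (isInvHolOn_exp hdH hγH))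
    have h2 := h _ (hinv 1)
    obtain ⟨y, hy, hry, e1, e2⟩ := hk z hz k
    have hk1 : Complex.exp (-(θ 1 * Complex.I) * k) = (u ^ k)⁻¹ := by
      rw [mul_comm, Complex.exp_int_mul, Complex.exp_neg, hexpθ, pow_one, inv_zpow]
    have : y = w := by
      rw [← hGH y hy, ← hGH w hw, e1, e2, hkz]
      congr 2
      simp only [hkz, mul_add, Complex.exp_add, hk1, pow_one] at h2
      have hne := Complex.exp_ne_zero (-(θ 1 * Complex.I) * H z)
      have huk : u ^ k ≠ 0 := zpow_ne_zero _ hu0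
      field_simp at h2
      linear_combination h2
    exact this ▸ hry
  · intro K hKΩ hK
    rcases K.eq_empty_or_nonempty with rfl | hne
    · exact ⟨∅, empty_subset _, isCompact_empty, fun z _ h => (not_memInvHull_empty z h).elim⟩
    obtain ⟨α, β, hs, hb⟩ := exists_im_mem_Icc hI hK hne (hdH.continuousOn.mono hKΩ)
      fun x hx => hmH (hKΩ hx)
    obtain ⟨x₀, hx₀, hmax⟩ := hK.exists_isMaxOn hne (hdB.continuousOn.mono hKΩ).norm
    set R := ‖B x₀‖ with hRdef
    have hR1 : R < 1 := by simpa using hmB (hKΩ hx₀)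
    have hR0 : 0 ≤ R := norm_nonneg _
    have hsub : (Icc 0 1 ×ℂ Icc α β) ×ˢ closedBall (0 : ℂ) R ⊆
        (Complex.im ⁻¹' I) ×ˢ ball 0 1 :=
      fun ζ hζ => ⟨hs hζ.1.2, closedBall_subset_ball hR1 hζ.2⟩
    refine ⟨G '' ((Icc 0 1 ×ℂ Icc α β) ×ˢ closedBall (0 : ℂ) R),
      (image_mono hsub).trans hGm.image_subset, ((isCompact_Icc.reProdIm isCompact_Icc).prod
        (isCompact_closedBall _ _)).image_of_continuousOn (hG.mono hsub), ?_⟩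
    intro z hz hull
    obtain ⟨y, hy, hry, e1, e2⟩ := hk z hz (-⌊(H z).re⌋)
    refine ⟨y, ⟨(H y, B y), ?_, hGH y hy⟩, hry⟩
    have i1 := hull.im_mem_Icc hdH hγH hb
    set T := max |α| |β| with hT
    have hTabs : ∀ t ∈ Icc α β, |t| ≤ T := fun t ht => abs_le_max_abs_abs ht.1 ht.2
    have hθT : ∀ n, ∀ t ∈ Icc α β, |θ n * t| ≤ Real.pi * T := fun n t ht => by
      rw [abs_mul]
      exact mul_le_mul (Complex.abs_arg_le_pi _) (hTabs t ht) (abs_nonneg _) Real.pi_pos.le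
    have hBz : ‖B z‖ ≤ R := by
      refine le_of_forall_pow_le_mul_pow (C := Real.exp (Real.pi * T) * Real.exp (Real.pi * T)) hR0
        fun n => ?_
      have h := hull _ (hinv n) (R ^ n * Real.exp (Real.pi * T)) (by positivity) fun x hx => by
        rw [norm_mul, norm_pow, hnorm]
        exact mul_le_mul (pow_le_pow_left₀ (norm_nonneg _) (hmax hx) n)
          (Real.exp_le_exp.2 (abs_le.1 (hθT n _ (hb x hx))).2) (by positivity) (by positivity)
      rw [norm_mul, norm_pow, hnorm] at h
      have h' : Real.exp (-(Real.pi * T)) ≤ Real.exp (θ n * (H z).im) :=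
        Real.exp_le_exp.2 (abs_le.1 (hθT n _ i1)).1
      rw [Real.exp_neg] at h'
      calc ‖B z‖ ^ n = ‖B z‖ ^ n * (Real.exp (Real.pi * T))⁻¹ * Real.exp (Real.pi * T) := by
            rw [inv_mul_cancel_right₀ (Real.exp_ne_zero _)]
        _ ≤ ‖B z‖ ^ n * Real.exp (θ n * (H z).im) * Real.exp (Real.pi * T) := by gcongr
        _ ≤ R ^ n * Real.exp (Real.pi * T) * Real.exp (Real.pi * T) := by gcongr
        _ = _ := by ring
    have hf := Int.fract_add_floor (H z).re
    have hf0 := Int.fract_nonneg (H z).re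
    have hf1 := (Int.fract_lt_one (H z).re).le
    rw [e1, e2]
    refine ⟨⟨?_, ?_⟩, ?_⟩
    · simp only [mem_preimage, Complex.add_re, Complex.neg_re, Complex.intCast_re, Int.cast_neg]
      constructor <;> linarith
    · simpa using i1
    · rw [mem_closedBall_zero_iff, norm_mul, norm_zpow, hu, one_zpow, one_mul]
      exact hBz

/-- The quotient by `γ` is Stein if the quotient by `γ ∘ γ` is. -/
lemma InvStein.of_sq (hr : IsOrbitRel Ω γ γ' r) (hγ : DifferentiableOn ℂ γ Ω)
    (h : InvStein Ω (γ ∘ γ) r) : InvStein Ω γ r := by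
  have hcomp : ∀ {f}, IsInvHolOn Ω (γ ∘ γ) f → DifferentiableOn ℂ (fun x => f (γ x)) Ω :=
    fun hf => hf.1.comp hγ hr.mapsTo
  constructor
  · intro z hz w hw hzw
    by_contra hnr
    have hnr' : ¬ r z (γ w) := fun h' => hnr <| by
      simpa [hr.left_inv w hw] using hr.bwd z hz _ (hr.mapsTo hw) h'
    have h1 := mt (h.separates z hz w hw) hnr
    have h2 := mt (h.separates z hz _ (hr.mapsTo hw)) hnr'
    push Not at h1 h2
    obtain ⟨f₁, hf₁, hne₁⟩ := h1
    obtain ⟨f₂, hf₂, hne₂⟩ := h2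
    set f : E → ℂ := fun x => (f₁ x - f₁ w) * (f₂ x - f₂ (γ w)) with hf
    have hfinv : IsInvHolOn Ω (γ ∘ γ) f := by
      refine ⟨(hf₁.1.sub_const _).mul (hf₂.1.sub_const _), fun x hx => ?_⟩
      simp only [hf, hf₁.2 x hx, hf₂.2 x hx]
    have hfz : f z ≠ 0 := mul_ne_zero (sub_ne_zero.2 hne₁) (sub_ne_zero.2 hne₂)
    have hfw : f w = 0 := by simp [hf]
    have hfw' : f (γ w) = 0 := by simp [hf]
    have key := hzw (fun x => (f x - f z) * (f (γ x) - f z))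
      ⟨(hfinv.1.sub_const _).mul ((hcomp hfinv).sub_const _), fun x hx => by
        have := hfinv.2 x hx
        simp only [Function.comp] at this
        simp only [this]
        ring⟩
    simp [hfw, hfw', hfz] at key
  · intro K hKΩ hK
    obtain ⟨L, hLΩ, hL, hhull⟩ := h.convex (K ∪ γ '' K)
      (union_subset hKΩ ((image_mono hKΩ).trans hr.mapsTo.image_subset))
      (hK.union (hK.image_of_continuousOn (hγ.continuousOn.mono hKΩ)))
    refine ⟨L, hLΩ, hL, fun z hz hz' => hhull z hz fun f hf R hR hfR => ?_⟩
    have hf2 : ∀ x ∈ Ω, f (γ (γ x)) = f x := hf.2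
    refine le_of_forall_pow_le_mul_pow (C := 3) hR fun n => ?_
    have hK1 : ∀ x ∈ K, ‖f x‖ ^ n ≤ R ^ n := fun x hx =>
      pow_le_pow_left₀ (norm_nonneg _) (hfR x (Or.inl hx)) n
    have hK2 : ∀ x ∈ K, ‖f (γ x)‖ ^ n ≤ R ^ n := fun x hx =>
      pow_le_pow_left₀ (norm_nonneg _) (hfR _ (Or.inr (mem_image_of_mem γ hx))) n
    have hRn : 0 ≤ R ^ n := by positivity
    have hs := hz' (fun x => f x ^ n + f (γ x) ^ n)
      ⟨(hf.1.pow n).add ((hcomp hf).pow n), fun x hx => by simp only [hf2 x hx]; ring⟩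
      (2 * R ^ n) (by positivity) fun x hx => by
        refine (norm_add_le _ _).trans ?_
        rw [norm_pow, norm_pow]
        linarith [hK1 x hx, hK2 x hx]
    have hp := hz' (fun x => f x ^ n * f (γ x) ^ n)
      ⟨(hf.1.pow n).mul ((hcomp hf).pow n), fun x hx => by simp only [hf2 x hx]; ring⟩
      (R ^ n * R ^ n) (by positivity) fun x hx => by
        rw [norm_mul, norm_pow, norm_pow]
        exact mul_le_mul (hK1 x hx) (hK2 x hx) (by positivity) hRn
    have hquad : f z ^ n * f z ^ n =
        (f z ^ n + f (γ z) ^ n) * f z ^ n - f z ^ n * f (γ z) ^ n := by ring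
    have hq : ‖f z‖ ^ n * ‖f z‖ ^ n ≤ 2 * R ^ n * ‖f z‖ ^ n + R ^ n * R ^ n := by
      calc ‖f z‖ ^ n * ‖f z‖ ^ n = ‖f z ^ n * f z ^ n‖ := by rw [norm_mul, norm_pow]
        _ ≤ ‖f z ^ n + f (γ z) ^ n‖ * ‖f z ^ n‖ + ‖f z ^ n * f (γ z) ^ n‖ := by
          rw [hquad, ← norm_mul]
          exact norm_sub_le _ _
        _ ≤ 2 * R ^ n * ‖f z‖ ^ n + R ^ n * R ^ n := by
          rw [norm_pow (f z)]
          gcongr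
    by_contra! hlt
    nlinarith

end InvStein

lemma isPSHOnR_log_norm {Ω : Set E} {P : E → ℂ} (hP : Differentiable ℂ P)
    (h0 : ∀ z ∈ Ω, P z ≠ 0) : IsPSHOnR (fun z => Real.log ‖P z‖) Ω := by
  refine ⟨ContinuousOn.upperSemicontinuousOn <| continuous_coe_real_ereal.comp_continuousOn <|
    hP.continuous.continuousOn.norm.log fun z hz => norm_ne_zero_iff.2 (h0 z hz), ?_⟩
  intro z v r hr hdisc f hf hbd w hw
  have key : ∀ w : ℂ, ‖w‖ ≤ r → (((Real.log ‖P (z + w • v)‖ : ℝ) : EReal) ≤ ((f w).re : EReal) ↔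
      ‖P (z + w • v) * Complex.exp (-f w)‖ ≤ 1) := fun w hw => by
    rw [EReal.coe_le_coe_iff, Real.log_le_iff_le_exp (norm_pos_iff.2 (h0 _ (hdisc w hw))),
      norm_mul, Complex.norm_exp, Complex.neg_re, Real.exp_neg, ← div_eq_mul_inv,
      div_le_one (Real.exp_pos _)]
  refine (key w hw).2 <| Complex.norm_le_of_forall_mem_frontier_norm_le (U := ball 0 r)
    (f := fun w => P (z + w • v) * Complex.exp (-f w)) isBounded_ball
    (Differentiable.diffContOnCl ?_) (fun ζ hζ => ?_) ?_
  · exact (hP.comp (by fun_prop : Differentiable ℂ fun w : ℂ => z + w • v)).mul hf.neg.cexp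
  · rw [frontier_ball _ hr.ne', mem_sphere_zero_iff_norm] at hζ
    exact (key ζ hζ.le).1 (hbd ζ hζ)
  · rwa [closure_ball _ hr.ne', mem_closedBall_zero_iff]

/-- The function `P` is bounded by one and vanishes nowhere on `Ω`, and it tends to `0` along the
orbits of `γ`, because it is small where `H` is large and `γ ∘ γ` translates `H` by `c`. -/
structure EscapeModel (Ω : Set E) (γ : E → E) (H P : E → ℂ) (c : ℂ) : Prop where
  differentiable : Differentiable ℂ P
  norm_lt_one : ∀ z ∈ Ω, ‖P z‖ < 1
  ne_zero : ∀ z ∈ Ω, P z ≠ 0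
  const_ne_zero : c ≠ 0
  map_sq : ∀ z ∈ Ω, H (γ (γ z)) = H z + c
  at_infinity : ∀ ε > 0, ∃ M : ℝ, ∀ z ∈ Ω, M < ‖H z‖ → ‖P z‖ < ε

section EscapeModel

variable {Ω : Set E} {γ γ' : E → E} {r : E → E → Prop} {H P : E → ℂ} {c : ℂ}

lemma EscapeModel.inv (h : EscapeModel Ω γ H P c) (hr : IsOrbitRel Ω γ γ' r) :
    EscapeModel Ω γ' H P (-c) where
  differentiable := h.differentiable
  norm_lt_one := h.norm_lt_one
  ne_zero := h.ne_zero
  const_ne_zero := neg_ne_zero.2 h.const_ne_zero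
  map_sq z hz := by
    have h1 := hr.mapsTo_inv hz
    have h2 := h.map_sq _ (hr.mapsTo_inv h1)
    rw [hr.right_inv _ h1, hr.right_inv _ hz] at h2
    linear_combination -h2
  at_infinity := h.at_infinity

lemma EscapeModel.finite_setOf_le (h : EscapeModel Ω γ H P c) (hγ : MapsTo γ Ω Ω) {a : E}
    (ha : a ∈ Ω) {ε : ℝ} (hε : 0 < ε) : {n : ℕ | ε ≤ ‖P (γ^[n] a)‖}.Finite := by
  have hmem : ∀ n, γ^[n] a ∈ Ω := fun n => hγ.iterate n ha
  set B := max ‖H a‖ ‖H (γ a) - c / 2‖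
  have hB : ∀ n : ℕ, ‖H (γ^[n] a) - n * c / 2‖ ≤ B := fun n => by
    induction n using Nat.twoStepInduction with
    | zero => simp [B]
    | one => simp [B]
    | more n ih _ =>
      convert ih using 2
      rw [Function.iterate_succ_apply', Function.iterate_succ_apply', h.map_sq _ (hmem n)]
      push_cast
      ring
  obtain ⟨M, hM⟩ := h.at_infinity ε hε
  have hc : 0 < ‖c‖ := norm_pos_iff.2 h.const_ne_zero
  obtain ⟨N, hN⟩ := exists_nat_gt ((M + B) * 2 / ‖c‖)
  refine (Set.finite_Iio N).subset fun n hn => ?_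
  by_contra! hle
  refine absurd (hM _ (hmem n) ?_) (not_lt.2 hn)
  have hNn : (N : ℝ) ≤ n := by exact_mod_cast not_lt.1 hle
  rw [div_lt_iff₀ hc] at hN
  have h1 : ‖(n : ℂ) * c / 2‖ = n * ‖c‖ / 2 := by simp
  have h2 := norm_sub_norm_le ((n : ℂ) * c / 2) (H (γ^[n] a))
  rw [norm_sub_rev, h1] at h2
  nlinarith [hB n]

lemma EscapeModel.eq_zero_of_accPt (h : EscapeModel Ω γ H P c) (hr : IsOrbitRel Ω γ γ' r)
    {a b : E} (ha : a ∈ Ω) {S : Set E} (hS : ∀ y ∈ S, ∃ n : ℕ, y = γ^[n] a ∨ y = γ'^[n] a)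
    (hb : AccPt b (𝓟 S)) : P b = 0 := by
  by_contra hne
  have hpos : 0 < ‖P b‖ := norm_pos_iff.2 hne
  have hV : {z | ‖P b‖ / 2 < ‖P z‖} ∈ 𝓝 b :=
    (isOpen_lt continuous_const h.differentiable.continuous.norm).mem_nhds (half_lt_self hpos)
  refine Set.Infinite.of_accPt (hb.nhds_inter hV) ?_
  refine (((h.finite_setOf_le hr.mapsTo ha (half_pos hpos)).image fun n => γ^[n] a).union
    (((h.inv hr).finite_setOf_le hr.mapsTo_inv ha (half_pos hpos)).image fun n => γ'^[n] a)).subset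
      ?_
  rintro y ⟨hy, hyS⟩
  have hy' : ‖P b‖ / 2 ≤ ‖P y‖ := le_of_lt hy
  obtain ⟨n, rfl | rfl⟩ := hS y hyS
  · exact Or.inl ⟨n, hy', rfl⟩
  · exact Or.inr ⟨n, hy', rfl⟩

end EscapeModel

lemma TranslationModel.escapeModel {φ h g : ℂ → ℂ} {I : Set ℝ} {p₁ p₂ : ℂ}
    (hT : TranslationModel φ h g I p₁ p₂) {Ω : Set E} {γ : E → E} {q : E → ℂ}
    (hq : Differentiable ℂ q) (hqm : MapsTo q Ω (ball 0 1)) {c : ℂ} (hc : c ≠ 0)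
    (hsq : ∀ z ∈ Ω, h (q (γ (γ z))) = h (q z) + c) :
    EscapeModel Ω γ (h ∘ q) (fun z => (q z - p₁) * (q z - p₂) / 4) c := by
  have hne : ∀ {p : ℂ}, ‖p‖ = 1 → ∀ z ∈ Ω, q z - p ≠ 0 := fun hp z hz h0 => by
    have := mem_ball_zero_iff.1 (hqm hz)
    rw [sub_eq_zero.1 h0, hp] at this
    exact lt_irrefl _ this
  have hlt : ∀ {p : ℂ}, ‖p‖ = 1 → ∀ z ∈ Ω, ‖q z - p‖ < 2 := fun hp z hz =>
    (norm_sub_le _ _).trans_lt (by linarith [mem_ball_zero_iff.1 (hqm hz)])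
  refine ⟨by fun_prop, fun z hz => ?_, fun z hz => ?_, hc, hsq, fun ε hε => ?_⟩
  · have h1 := hlt hT.norm_left z hz
    have h2 := hlt hT.norm_right z hz
    rw [norm_div, norm_mul, Complex.norm_ofNat, div_lt_one (by norm_num)]
    nlinarith [norm_nonneg (q z - p₁), norm_nonneg (q z - p₂)]
  · exact div_ne_zero (mul_ne_zero (hne hT.norm_left z hz) (hne hT.norm_right z hz)) (by norm_num)
  · obtain ⟨M, hM⟩ := hT.at_infinity (ε * 4) (by positivity)
    refine ⟨M, fun z hz hz' => ?_⟩
    rw [norm_div, norm_mul, Complex.norm_ofNat, div_lt_iff₀ (by norm_num)]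
    exact hM _ (hqm hz) hz'

section Bidisc

variable {γ γ' : ℂ × ℂ → ℂ × ℂ} {r : ℂ × ℂ → ℂ × ℂ → Prop}

lemma mapsTo_fst_bidisc : MapsTo (Prod.fst : ℂ × ℂ → ℂ) (ball 0 1 ×ˢ ball 0 1) (ball 0 1) :=
  fun _ hz => hz.1

lemma mapsTo_snd_bidisc : MapsTo (Prod.snd : ℂ × ℂ → ℂ) (ball 0 1 ×ˢ ball 0 1) (ball 0 1) :=
  fun _ hz => hz.2

lemma invStein_bidisc_of_translation_translation
    (hr : IsOrbitRel (ball (0 : ℂ) 1 ×ˢ ball (0 : ℂ) 1) γ γ' r) {φ₁ h₁ g₁ φ₂ h₂ g₂ : ℂ → ℂ}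
    {I₁ I₂ : Set ℝ} {p₁ p₂ q₁ q₂ : ℂ} (h1 : TranslationModel φ₁ h₁ g₁ I₁ p₁ p₂)
    (h2 : TranslationModel φ₂ h₂ g₂ I₂ q₁ q₂)
    (hγ : ∀ z ∈ ball (0 : ℂ) 1 ×ˢ ball (0 : ℂ) 1, γ z = (φ₁ z.1, φ₂ z.2)) :
    InvStein (ball (0 : ℂ) 1 ×ˢ ball (0 : ℂ) 1) γ r :=
  .of_translation_translation hr (H₁ := fun z => h₁ z.1) (H₂ := fun z => h₂ z.2)
    (G := fun ζ => (g₁ ζ.1, g₂ ζ.2)) h1.ordConnected h2.ordConnected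
    (h1.differentiableOn.comp (by fun_prop) mapsTo_fst_bidisc)
    (h2.differentiableOn.comp (by fun_prop) mapsTo_snd_bidisc)
    (h1.mapsTo.comp mapsTo_fst_bidisc) (h2.mapsTo.comp mapsTo_snd_bidisc)
    ((h1.continuousOn_inv.comp continuousOn_fst fun _ hζ => hζ.1).prodMk
      (h2.continuousOn_inv.comp continuousOn_snd fun _ hζ => hζ.2))
    (fun _ hζ => ⟨h1.mapsTo_inv hζ.1, h2.mapsTo_inv hζ.2⟩)
    (fun z hz => Prod.ext (h1.left_inv _ hz.1) (h2.left_inv _ hz.2))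
    (fun z hz => by rw [hγ z hz]; exact h1.map_eq _ hz.1)
    (fun z hz => by rw [hγ z hz]; exact h2.map_eq _ hz.2)

lemma invStein_bidisc_of_translation_rotation
    (hr : IsOrbitRel (ball (0 : ℂ) 1 ×ˢ ball (0 : ℂ) 1) γ γ' r) {φ₁ h₁ g₁ φ₂ B₂ g₂ : ℂ → ℂ}
    {I₁ : Set ℝ} {p₁ p₂ u : ℂ} (h1 : TranslationModel φ₁ h₁ g₁ I₁ p₁ p₂)
    (h2 : RotationModel φ₂ B₂ g₂ u)
    (hγ : ∀ z ∈ ball (0 : ℂ) 1 ×ˢ ball (0 : ℂ) 1, γ z = (φ₁ z.1, φ₂ z.2)) :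
    InvStein (ball (0 : ℂ) 1 ×ˢ ball (0 : ℂ) 1) γ r :=
  .of_translation_rotation hr (H := fun z => h₁ z.1) (B := fun z => B₂ z.2)
    (G := fun ζ => (g₁ ζ.1, g₂ ζ.2)) h2.norm_eq h1.ordConnected
    (h1.differentiableOn.comp (by fun_prop) mapsTo_fst_bidisc)
    (h2.differentiableOn.comp (by fun_prop) mapsTo_snd_bidisc)
    (h1.mapsTo.comp mapsTo_fst_bidisc) (h2.mapsTo.comp mapsTo_snd_bidisc)
    ((h1.continuousOn_inv.comp continuousOn_fst fun _ hζ => hζ.1).prodMk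
      (h2.continuousOn_inv.comp continuousOn_snd fun _ hζ => hζ.2))
    (fun _ hζ => ⟨h1.mapsTo_inv hζ.1, h2.mapsTo_inv hζ.2⟩)
    (fun z hz => Prod.ext (h1.left_inv _ hz.1) (h2.left_inv _ hz.2))
    (fun z hz => by rw [hγ z hz]; exact h1.map_eq _ hz.1)
    (fun z hz => by rw [hγ z hz]; exact h2.map_eq _ hz.2)

lemma invStein_bidisc_of_rotation_translation
    (hr : IsOrbitRel (ball (0 : ℂ) 1 ×ˢ ball (0 : ℂ) 1) γ γ' r) {φ₁ B₁ g₁ φ₂ h₂ g₂ : ℂ → ℂ}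
    {I₂ : Set ℝ} {p₁ p₂ u : ℂ} (h1 : RotationModel φ₁ B₁ g₁ u)
    (h2 : TranslationModel φ₂ h₂ g₂ I₂ p₁ p₂)
    (hγ : ∀ z ∈ ball (0 : ℂ) 1 ×ˢ ball (0 : ℂ) 1, γ z = (φ₁ z.1, φ₂ z.2)) :
    InvStein (ball (0 : ℂ) 1 ×ˢ ball (0 : ℂ) 1) γ r :=
  .of_translation_rotation hr (H := fun z => h₂ z.2) (B := fun z => B₁ z.1)
    (G := fun ζ => (g₁ ζ.2, g₂ ζ.1)) h1.norm_eq h2.ordConnected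
    (h2.differentiableOn.comp (by fun_prop) mapsTo_snd_bidisc)
    (h1.differentiableOn.comp (by fun_prop) mapsTo_fst_bidisc)
    (h2.mapsTo.comp mapsTo_snd_bidisc) (h1.mapsTo.comp mapsTo_fst_bidisc)
    ((h1.continuousOn_inv.comp continuousOn_snd fun _ hζ => hζ.2).prodMk
      (h2.continuousOn_inv.comp continuousOn_fst fun _ hζ => hζ.1))
    (fun _ hζ => ⟨h1.mapsTo_inv hζ.2, h2.mapsTo_inv hζ.1⟩)
    (fun z hz => Prod.ext (h1.left_inv _ hz.1) (h2.left_inv _ hz.2))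
    (fun z hz => by rw [hγ z hz]; exact h2.map_eq _ hz.2)
    (fun z hz => by rw [hγ z hz]; exact h1.map_eq _ hz.1)

lemma TranslationModel.map_map {φ h g : ℂ → ℂ} {I : Set ℝ} {p₁ p₂ : ℂ}
    (hT : TranslationModel φ h g I p₁ p₂) (hφ : MapsTo φ (ball 0 1) (ball 0 1)) {z : ℂ}
    (hz : z ∈ ball (0 : ℂ) 1) : h (φ (φ z)) = h z + 2 := by
  rw [hT.map_eq _ (hφ hz), hT.map_eq _ hz, add_assoc, one_add_one_eq_two]

/-- A product automorphism of the bidisc without fixed points. -/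
lemma invStein_bidisc_of_prod (hr : IsOrbitRel (ball (0 : ℂ) 1 ×ˢ ball (0 : ℂ) 1) γ γ' r)
    (hfix : ∀ z ∈ ball (0 : ℂ) 1 ×ˢ ball (0 : ℂ) 1, γ z ≠ z) {u a v b : ℂ} (hu : ‖u‖ = 1)
    (ha : ‖a‖ < 1) (hv : ‖v‖ = 1) (hb : ‖b‖ < 1)
    (hγ : ∀ z ∈ ball (0 : ℂ) 1 ×ˢ ball (0 : ℂ) 1,
      γ z = (discMoebius u a z.1, discMoebius v b z.2)) :
    InvStein (ball (0 : ℂ) 1 ×ˢ ball (0 : ℂ) 1) γ r ∧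
      ∃ H P c, EscapeModel (ball (0 : ℂ) 1 ×ˢ ball (0 : ℂ) 1) γ H P c := by
  have hesc₁ : ∀ {h g I p₁ p₂}, TranslationModel (discMoebius u a) h g I p₁ p₂ →
      ∃ H P c, EscapeModel (ball (0 : ℂ) 1 ×ˢ ball (0 : ℂ) 1) γ H P c := fun hT =>
    ⟨_, _, 2, hT.escapeModel differentiable_fst mapsTo_fst_bidisc two_ne_zero fun z hz => by
      rw [hγ _ (hr.mapsTo hz), hγ z hz]
      exact hT.map_map (discMoebius_mapsTo hu ha) hz.1⟩
  by_cases h1 : ∃ c₁ ∈ ball (0 : ℂ) 1, discMoebius u a c₁ = c₁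
  · obtain ⟨c₁, hc₁, hfix₁⟩ := h1
    obtain ⟨B, g, w, hB⟩ := exists_rotationModel hu ha (mem_ball_zero_iff.1 hc₁) hfix₁
    have h2 : ∀ z ∈ ball (0 : ℂ) 1, discMoebius v b z ≠ z := fun c₂ hc₂ hfix₂ =>
      hfix (c₁, c₂) ⟨hc₁, hc₂⟩ (by rw [hγ _ ⟨hc₁, hc₂⟩, hfix₁, hfix₂])
    obtain ⟨h, g', I, p₁, p₂, hT⟩ := exists_translationModel hv hb h2
    exact ⟨invStein_bidisc_of_rotation_translation hr hB hT hγ, _, _, 2,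
      hT.escapeModel differentiable_snd mapsTo_snd_bidisc two_ne_zero fun z hz => by
        rw [hγ _ (hr.mapsTo hz), hγ z hz]
        exact hT.map_map (discMoebius_mapsTo hv hb) hz.2⟩
  · push Not at h1
    obtain ⟨h, g, I, p₁, p₂, hT⟩ := exists_translationModel hu ha h1
    by_cases h2 : ∃ c₂ ∈ ball (0 : ℂ) 1, discMoebius v b c₂ = c₂
    · obtain ⟨c₂, hc₂, hfix₂⟩ := h2
      obtain ⟨B, g', w, hB⟩ := exists_rotationModel hv hb (mem_ball_zero_iff.1 hc₂) hfix₂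
      exact ⟨invStein_bidisc_of_translation_rotation hr hT hB hγ, hesc₁ hT⟩
    · push Not at h2
      obtain ⟨h', g', I', q₁, q₂, hT'⟩ := exists_translationModel hv hb h2
      exact ⟨invStein_bidisc_of_translation_translation hr hT hT' hγ, hesc₁ hT⟩

lemma discMoebius_zero_ne_half {u a : ℂ} (hu : ‖u‖ = 1) (ha : ‖a‖ < 1) :
    discMoebius u a 0 ≠ discMoebius u a (1 / 2) := by
  intro h
  have hd := discMoebius_denom_ne_zero hu ha (z := 1 / 2) (by norm_num)
  have hu0 : u ≠ 0 := by rintro rfl; simp at hu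
  simp only [discMoebius, mul_zero, zero_add, add_zero, div_one] at h
  rw [eq_div_iff hd] at h
  have h1 : a * star a = 1 := mul_right_cancel₀ hu0 (by linear_combination 2 * h)
  have h2 : ‖a‖ * ‖a‖ = 1 := by simpa using congrArg norm h1
  nlinarith [norm_nonneg a]

/-- An automorphism of the bidisc that swaps the factors and has no fixed points. -/
lemma invStein_bidisc_of_swap (hr : IsOrbitRel (ball (0 : ℂ) 1 ×ˢ ball (0 : ℂ) 1) γ γ' r)
    (hdiff : DifferentiableOn ℂ γ (ball (0 : ℂ) 1 ×ˢ ball (0 : ℂ) 1))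
    (hsq : IsAutOn (ball (0 : ℂ) 1 ×ˢ ball (0 : ℂ) 1) (γ ∘ γ))
    (hfix : ∀ z ∈ ball (0 : ℂ) 1 ×ˢ ball (0 : ℂ) 1, γ z ≠ z) {φ ψ : ℂ → ℂ}
    (hφ : MapsTo φ (ball 0 1) (ball 0 1)) (hψ : MapsTo ψ (ball 0 1) (ball 0 1))
    (hγ : ∀ z ∈ ball (0 : ℂ) 1 ×ˢ ball (0 : ℂ) 1, γ z = (φ z.2, ψ z.1)) :
    InvStein (ball (0 : ℂ) 1 ×ˢ ball (0 : ℂ) 1) γ r ∧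
      ∃ H P c, EscapeModel (ball (0 : ℂ) 1 ×ˢ ball (0 : ℂ) 1) γ H P c := by
  have h0 : (0 : ℂ) ∈ ball (0 : ℂ) 1 := by simp
  have hhalf : (1 / 2 : ℂ) ∈ ball (0 : ℂ) 1 := by rw [mem_ball_zero_iff]; norm_num
  have hγγ : ∀ z ∈ ball (0 : ℂ) 1 ×ˢ ball (0 : ℂ) 1, (γ ∘ γ) z = (φ (ψ z.1), ψ (φ z.2)) :=
    fun z hz => by rw [Function.comp_apply, hγ _ (hr.mapsTo hz), hγ z hz]
  obtain ⟨u, a, v, b, hu, ha, hv, hb, h | h⟩ := hsq.bidisc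
  · have e1 : ∀ z ∈ ball (0 : ℂ) 1, discMoebius u a z = φ (ψ z) := fun z hz =>
      congrArg Prod.fst ((h (z, 0) ⟨hz, h0⟩).symm.trans (hγγ (z, 0) ⟨hz, h0⟩))
    have e2 : ∀ z ∈ ball (0 : ℂ) 1, discMoebius v b z = ψ (φ z) := fun z hz =>
      congrArg Prod.snd ((h (0, z) ⟨h0, hz⟩).symm.trans (hγγ (0, z) ⟨h0, hz⟩))
    obtain ⟨h₁, g₁, I₁, p₁, p₂, hT₁⟩ := exists_translationModel hu ha fun z hz hz' => by
      have hm : (z, ψ z) ∈ ball (0 : ℂ) 1 ×ˢ ball (0 : ℂ) 1 := ⟨hz, hψ hz⟩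
      exact hfix _ hm (by rw [hγ _ hm, ← e1 z hz, hz'])
    obtain ⟨h₂, g₂, I₂, q₁, q₂, hT₂⟩ := exists_translationModel hv hb fun z hz hz' => by
      have hm : (φ z, z) ∈ ball (0 : ℂ) 1 ×ˢ ball (0 : ℂ) 1 := ⟨hφ hz, hz⟩
      exact hfix _ hm (by rw [hγ _ hm, ← e2 z hz, hz'])
    exact ⟨(invStein_bidisc_of_translation_translation hr.sq hT₁ hT₂ h).of_sq hr hdiff, _, _, 1,
      hT₁.escapeModel differentiable_fst mapsTo_fst_bidisc one_ne_zero fun z hz => by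
        rw [← Function.comp_apply (f := γ), h z hz]
        exact hT₁.map_eq _ hz.1⟩
  · have e : ∀ z ∈ ball (0 : ℂ) 1, discMoebius u a z = φ (ψ 0) := fun z hz =>
      congrArg Prod.fst ((h (0, z) ⟨h0, hz⟩).symm.trans (hγγ (0, z) ⟨h0, hz⟩))
    exact (discMoebius_zero_ne_half hu ha ((e _ h0).trans (e _ hhalf).symm)).elim

lemma invStein_bidisc (hr : IsOrbitRel (ball (0 : ℂ) 1 ×ˢ ball (0 : ℂ) 1) γ γ' r)
    (haut : IsAutOn (ball (0 : ℂ) 1 ×ˢ ball (0 : ℂ) 1) γ)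
    (hsq : IsAutOn (ball (0 : ℂ) 1 ×ˢ ball (0 : ℂ) 1) (γ ∘ γ))
    (hfix : ∀ z ∈ ball (0 : ℂ) 1 ×ˢ ball (0 : ℂ) 1, γ z ≠ z) :
    InvStein (ball (0 : ℂ) 1 ×ˢ ball (0 : ℂ) 1) γ r ∧
      ∃ H P c, EscapeModel (ball (0 : ℂ) 1 ×ˢ ball (0 : ℂ) 1) γ H P c := by
  obtain ⟨u, a, v, b, hu, ha, hv, hb, h | h⟩ := haut.bidisc
  · exact invStein_bidisc_of_prod hr hfix hu ha hv hb h
  · exact invStein_bidisc_of_swap hr haut.1 hsq hfix (discMoebius_mapsTo hu ha)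
      (discMoebius_mapsTo hv hb) h

end Bidisc

/-- Two maps are inverse to each other and generate the cyclic group `Γ` of automorphisms. -/
structure IsCyclicGen {X : Type*} (Ω : Set X) (Γ : Set (X → X)) (γ γ' : X → X) : Prop where
  mem : γ ∈ Γ
  inv_mem : γ' ∈ Γ
  left_inv : ∀ x ∈ Ω, γ' (γ x) = x
  right_inv : ∀ x ∈ Ω, γ (γ' x) = x
  exists_iterate : ∀ σ ∈ Γ, ∃ n : ℕ, EqOn σ γ^[n] Ω ∨ EqOn σ γ'^[n] Ω

lemma IsCyclicAutGroupOn.exists_gen {X : Type*} {Ω : Set X} {Γ : Set (X → X)}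
    (h : IsCyclicAutGroupOn Ω Γ) :
    ∃ γ γ', IsCyclicGen Ω Γ γ γ' := by
  obtain ⟨γ, hγ, γ', hγ', hl, hr, -, hex⟩ := h
  refine ⟨γ, γ', hγ, hγ', hl, hr, fun σ hσ => ?_⟩
  obtain ⟨k | k, hk⟩ := hex σ hσ
  · exact ⟨k, Or.inl hk⟩
  · exact ⟨k + 1, Or.inr hk⟩

namespace IsCyclicGen

variable {Ω : Set E} {Γ : Set (E → E)} {γ γ' : E → E}

lemma isOrbitRel (h : IsCyclicGen Ω Γ γ γ') (hΓ : IsAutGroupOn Ω Γ) :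
    IsOrbitRel Ω γ γ' fun z w => ∃ σ ∈ Γ, σ z = w where
  mapsTo := (hΓ.aut γ h.mem).2.1
  mapsTo_inv := (hΓ.aut γ' h.inv_mem).2.1
  left_inv := h.left_inv
  right_inv := h.right_inv
  refl _ _ := ⟨id, hΓ.id_mem, rfl⟩
  fwd _ _ _ _ := fun ⟨σ, hσ, hxy⟩ => ⟨γ ∘ σ, hΓ.comp_mem _ h.mem _ hσ, congrArg γ hxy⟩
  bwd _ _ _ _ := fun ⟨σ, hσ, hxy⟩ => ⟨γ' ∘ σ, hΓ.comp_mem _ h.inv_mem _ hσ, congrArg γ' hxy⟩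

lemma ne_of_infinite {X : Type*} [NormedAddCommGroup X] {Ω : Set X} {Γ : Set (X → X)}
    {γ γ' : X → X} (h : IsCyclicGen Ω Γ γ γ') (hinf : Γ.Infinite)
    (hpd : ProperlyDiscontinuousOn Ω Γ) : ∀ z ∈ Ω, γ z ≠ z := by
  intro z hz hfix
  have hfix' : γ' z = z := by simpa [hfix] using h.left_inv z hz
  refine hinf ((hpd {z} {z} (by simpa) (by simpa) isCompact_singleton isCompact_singleton).subset
    fun σ hσ => ⟨hσ, z, ⟨z, rfl, ?_⟩, rfl⟩)
  obtain ⟨n, hn | hn⟩ := h.exists_iterate σ hσ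
  · rw [hn hz, Function.iterate_fixed hfix]
  · rw [hn hz, Function.iterate_fixed hfix']

lemma invariant (h : IsCyclicGen Ω Γ γ γ') (hΓ : IsAutGroupOn Ω Γ) {f : E → ℂ}
    (hf : IsInvHolOn Ω γ f) : ∀ σ ∈ Γ, ∀ x ∈ Ω, f (σ x) = f x := by
  have hr := h.isOrbitRel hΓ
  have hit : ∀ {δ : E → E}, MapsTo δ Ω Ω → (∀ x ∈ Ω, f (δ x) = f x) →
      ∀ n : ℕ, ∀ x ∈ Ω, f (δ^[n] x) = f x := fun hδ hfδ n x hx => by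
    induction n with
    | zero => rfl
    | succ n ih => rw [Function.iterate_succ_apply', hfδ _ (hδ.iterate n hx), ih]
  intro σ hσ x hx
  obtain ⟨n, hn | hn⟩ := h.exists_iterate σ hσ
  · rw [hn hx, hit hr.mapsTo hf.2 n x hx]
  · rw [hn hx, hit hr.mapsTo_inv (fun y hy => by
      rw [← hf.2 _ (hr.mapsTo_inv hy), h.right_inv y hy]) n x hx]

lemma quotientIsStein (h : IsCyclicGen Ω Γ γ γ') (hΓ : IsAutGroupOn Ω Γ)
    (hS : InvStein Ω γ fun z w => ∃ σ ∈ Γ, σ z = w) : QuotientIsStein Ω Γ := by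
  constructor
  · intro z hz w hw hzw
    by_contra! hno
    obtain ⟨σ, hσ, hσz⟩ := hS.separates z hz w hw fun f hf => hno f hf.1 (h.invariant hΓ hf)
    exact hzw σ hσ hσz
  · intro K hKΩ hK
    obtain ⟨L, hLΩ, hL, hhull⟩ := hS.convex K hKΩ hK
    refine ⟨L, hLΩ, hL, fun z ⟨hz, hz'⟩ => ?_⟩
    obtain ⟨y, hy, σ, hσ, rfl⟩ := hhull z hz fun f hf R hR hfR =>
      (hz' f hf.1 (h.invariant hΓ hf)).trans <| Real.sSup_le (by simpa using hfR) hR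
    obtain ⟨τ, hτ, hτσ, -⟩ := hΓ.inv_mem σ hσ
    exact mem_iUnion₂.2 ⟨τ, hτ, _, hy, hτσ hz⟩

end IsCyclicGen

lemma EscapeModel.exists_psh {Ω : Set E} {Γ : Set (E → E)} {γ γ' : E → E} {H P : E → ℂ} {c : ℂ}
    (h : EscapeModel Ω γ H P c) (hgen : IsCyclicGen Ω Γ γ γ') (hΓ : IsAutGroupOn Ω Γ) {D : Set E}
    (hD : D ⊆ Ω) :
    ∃ ψ : E → ℝ, ContinuousOn ψ Ω ∧ IsPSHOnR ψ Ω ∧ (∀ z ∈ Ω, ψ z < 0) ∧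
      ∀ C : ℝ, ∃ U : Set E, IsOpen U ∧ (⋃ a ∈ D, clusterPtsOfOrbit Γ a) ⊆ U ∧
        ∀ z ∈ Ω ∩ U, ψ z < C := by
  have hcont : Continuous fun z => ‖P z‖ := h.differentiable.continuous.norm
  refine ⟨fun z => Real.log ‖P z‖,
    hcont.continuousOn.log fun z hz => norm_ne_zero_iff.2 (h.ne_zero z hz),
    isPSHOnR_log_norm h.differentiable h.ne_zero,
    fun z hz => Real.log_neg (norm_pos_iff.2 (h.ne_zero z hz)) (h.norm_lt_one z hz), fun C =>
    ⟨{z | ‖P z‖ < Real.exp C}, isOpen_lt hcont continuous_const, iUnion₂_subset fun a ha b hb => ?_,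
      fun z hz => (Real.log_lt_iff_lt_exp (norm_pos_iff.2 (h.ne_zero z hz.1))).2 hz.2⟩⟩
  have hb0 : P b = 0 := by
    refine h.eq_zero_of_accPt (hgen.isOrbitRel hΓ) (hD ha) ?_ hb
    rintro _ ⟨σ, hσ, rfl⟩
    obtain ⟨n, hn⟩ := hgen.exists_iterate σ hσ
    exact ⟨n, hn.imp (fun hn => hn (hD ha)) fun hn => hn (hD ha)⟩
  simpa [hb0] using Real.exp_pos C

/-- **Theorem 7.** Every infinite, cyclic, free, properly discontinuous group `Γ` of
automorphisms of the bidisc `Δ² ⊂ ℂ²` satisfies the condition of Theorem 5: there exists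
a negative continuous plurisubharmonic function `ψ` on `Δ²` (real-valued, so `ψ > -∞`)
with `ψ(z) → -∞` as `z → ⋃_{a ∈ D} CΓ_a`, for any fundamental domain `D` of `Γ`.
In particular, the quotient `Δ²/Γ` is a Stein manifold. -/
theorem bidisc_cyclic_quotient_stein
    (Γ : Set (ℂ × ℂ → ℂ × ℂ))
    (hgrp : IsAutGroupOn ((ball (0 : ℂ) 1) ×ˢ (ball (0 : ℂ) 1)) Γ)
    (hinf : Γ.Infinite)
    (hcyc : IsCyclicAutGroupOn ((ball (0 : ℂ) 1) ×ˢ (ball (0 : ℂ) 1)) Γ)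
    (hfree : FreeActionOn ((ball (0 : ℂ) 1) ×ˢ (ball (0 : ℂ) 1)) Γ)
    (hpd : ProperlyDiscontinuousOn ((ball (0 : ℂ) 1) ×ˢ (ball (0 : ℂ) 1)) Γ) :
    (∀ D : Set (ℂ × ℂ), IsFundamentalDomainOn ((ball (0 : ℂ) 1) ×ˢ (ball (0 : ℂ) 1)) Γ D →
      ∃ ψ : ℂ × ℂ → ℝ,
        ContinuousOn ψ ((ball (0 : ℂ) 1) ×ˢ (ball (0 : ℂ) 1)) ∧
        IsPSHOnR ψ ((ball (0 : ℂ) 1) ×ˢ (ball (0 : ℂ) 1)) ∧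
        (∀ z ∈ (ball (0 : ℂ) 1) ×ˢ (ball (0 : ℂ) 1), ψ z < 0) ∧
        ∀ C : ℝ, ∃ U : Set (ℂ × ℂ), IsOpen U ∧ (⋃ a ∈ D, clusterPtsOfOrbit Γ a) ⊆ U ∧
          ∀ z ∈ ((ball (0 : ℂ) 1) ×ˢ (ball (0 : ℂ) 1)) ∩ U, ψ z < C) ∧
    QuotientIsStein ((ball (0 : ℂ) 1) ×ˢ (ball (0 : ℂ) 1)) Γ := by
  obtain ⟨γ, γ', hgen⟩ := hcyc.exists_gen
  obtain ⟨hS, H, P, c, hE⟩ := invStein_bidisc (hgen.isOrbitRel hgrp) (hgrp.aut γ hgen.mem)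
    (hgrp.aut _ (hgrp.comp_mem γ hgen.mem γ hgen.mem)) (hgen.ne_of_infinite hinf hpd)
  exact ⟨fun D hD => hE.exists_psh hgen hgrp hD.1, hgen.quotientIsStein hgrp hS⟩

end
end

section
/- Let Ω be a bounded domain in ℂⁿ, Γ a countable subgroup of Aut(Ω), and τ a positive continuous function on Ω. If there exists a ∈ Ω such that ∑_{γ∈Γ} τ(γ(a)) < ∞, then Γ acts properly discontinuously on Ω. -/
open Set Metric Filter MeasureTheory Topology

noncomputable section

variable {E : Type*} [NormedAddCommGroup E] [NormedSpace ℂ E]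

/-- The closed ball of radius `r` around `y` in `Ω` for the `Γ`-invariant distance
`(x, y) ↦ sup_{σ ∈ Γ} dist (σ x) (σ y)`. -/
def invBall (Ω : Set E) (Γ : Set (E → E)) (r : ℝ) (y : E) : Set E :=
  {x ∈ Ω | ∀ σ ∈ Γ, dist (σ x) (σ y) ≤ r}

/-- `Γ` moves the point `z` into any compact subset of `Ω` only finitely many times. -/
def HasDiscreteOrbit (Ω : Set E) (Γ : Set (E → E)) (z : E) : Prop :=
  ∀ K ⊆ Ω, IsCompact K → {γ ∈ Γ | γ z ∈ K}.Finite

section InvBall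

variable {Ω K : Set E} {Γ : Set (E → E)} {r : ℝ} {x y : E}

theorem mem_invBall_comm (hx : x ∈ Ω) (hy : y ∈ Ω) :
    x ∈ invBall Ω Γ r y ↔ y ∈ invBall Ω Γ r x := by
  simp [invBall, hx, hy, dist_comm]

theorem IsAutGroupOn.invBall_subset_closedBall (hΓ : IsAutGroupOn Ω Γ) :
    invBall Ω Γ r y ⊆ closedBall y r :=
  fun _ hx => hx.2 id hΓ.id_mem

theorem IsAutGroupOn.image_mem_invBall (hΓ : IsAutGroupOn Ω Γ) {γ : E → E} (hγ : γ ∈ Γ)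
    (hx : x ∈ invBall Ω Γ r y) : γ x ∈ invBall Ω Γ r (γ y) :=
  ⟨(hΓ.aut γ hγ).2.1 hx.1, fun σ hσ => hx.2 (σ ∘ γ) (hΓ.comp_mem σ hσ γ hγ)⟩

/-- By the Schwarz lemma, a group of automorphisms of a bounded open set is locally
equi-Lipschitz, so invariant balls are neighbourhoods of their centres. -/
theorem IsAutGroupOn.invBall_mem_nhds (hΓ : IsAutGroupOn Ω Γ) (hopen : IsOpen Ω)
    (hbdd : Bornology.IsBounded Ω) (hr : 0 < r) (hy : y ∈ Ω) : invBall Ω Γ r y ∈ 𝓝 y := by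
  obtain ⟨R, hR, hball⟩ := Metric.isOpen_iff.1 hopen y hy
  obtain ⟨C, hC⟩ := Metric.isBounded_iff.1 hbdd
  have hsmall : ∀ᶠ x in 𝓝 y, C / R * dist x y < r := by
    have hcont : Continuous fun x => C / R * dist x y := by fun_prop
    exact hcont.continuousAt.eventually_lt continuousAt_const (by simpa using hr)
  filter_upwards [hsmall, ball_mem_nhds y hR] with x hx hxR
  refine ⟨hball hxR, fun σ hσ => ?_⟩
  obtain ⟨hdiff, hmaps, -⟩ := hΓ.aut σ hσ
  exact (Complex.dist_le_div_mul_dist_of_mapsTo_ball (hdiff.mono hball)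
    (fun z hz => hC (hmaps (hball hz)) (hmaps hy)) hxR).trans hx.le

theorem IsAutGroupOn.isCompact_invBall [ProperSpace E] (hΓ : IsAutGroupOn Ω Γ)
    (hy : closedBall y r ⊆ Ω) : IsCompact (invBall Ω Γ r y) := by
  have heq : invBall Ω Γ r y =
      closedBall y r ∩ ⋂ σ ∈ Γ, closedBall y r ∩ σ ⁻¹' closedBall (σ y) r := by
    ext x
    simp only [invBall, mem_ofPred_eq, mem_inter_iff, mem_iInter, mem_preimage,
      Metric.mem_closedBall]
    exact ⟨fun h => ⟨h.2 id hΓ.id_mem, fun σ hσ => ⟨h.2 id hΓ.id_mem, h.2 σ hσ⟩⟩,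
      fun h => ⟨hy h.1, fun σ hσ => (h.2 σ hσ).2⟩⟩
  rw [heq]
  refine (isCompact_closedBall y r).inter_right (isClosed_biInter fun σ hσ => ?_)
  exact ((hΓ.aut σ hσ).1.continuousOn.mono hy).preimage_isClosed_of_isClosed
    isClosed_closedBall isClosed_closedBall

/-- If the orbit of `y` is discrete, then only finitely many elements of `Γ` move a small
invariant ball around `y` into a given compact set. -/
theorem IsAutGroupOn.finite_image_invBall_inter [ProperSpace E] (hΓ : IsAutGroupOn Ω Γ)
    (hopen : IsOpen Ω) (hbdd : Bornology.IsBounded Ω) (hr : 0 < r)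
    (hball : closedBall y (4 * r) ⊆ Ω) (hy : HasDiscreteOrbit Ω Γ y)
    (hKΩ : K ⊆ Ω) (hK : IsCompact K) :
    {γ ∈ Γ | (γ '' invBall Ω Γ r y ∩ K).Nonempty}.Finite := by
  have hyΩ : y ∈ Ω := hball (mem_closedBall_self (by positivity))
  refine hK.induction_on (p := fun s => {γ ∈ Γ | (γ '' invBall Ω Γ r y ∩ s).Nonempty}.Finite)
    (by simp) (fun s t hst ht => ht.subset fun γ hγ => ⟨hγ.1, hγ.2.mono (by gcongr)⟩)
    (fun s t hs ht => (hs.union ht).subset fun γ hγ => ?_) fun k hk => ?_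
  · rw [mem_ofPred_eq, inter_union_distrib_left, union_nonempty] at hγ
    exact hγ.2.imp (fun h => ⟨hγ.1, h⟩) fun h => ⟨hγ.1, h⟩
  refine ⟨invBall Ω Γ r k,
    mem_nhdsWithin_of_mem_nhds (hΓ.invBall_mem_nhds hopen hbdd hr (hKΩ hk)), ?_⟩
  have hnear : ∀ γ ∈ {γ ∈ Γ | (γ '' invBall Ω Γ r y ∩ invBall Ω Γ r k).Nonempty},
      γ y ∈ invBall Ω Γ (2 * r) k := by
    rintro γ ⟨hγ, _, ⟨x, hx, rfl⟩, hxk⟩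
    refine ⟨(hΓ.aut γ hγ).2.1 hyΩ, fun σ hσ => ?_⟩
    have h₁ := (hΓ.image_mem_invBall hγ hx).2 σ hσ
    have h₂ := hxk.2 σ hσ
    linarith [dist_triangle_left (σ (γ y)) (σ k) (σ (γ x))]
  obtain hempty | ⟨γ₀, hγ₀⟩ :=
    {γ ∈ Γ | (γ '' invBall Ω Γ r y ∩ invBall Ω Γ r k).Nonempty}.eq_empty_or_nonempty
  · rw [hempty]
    exact finite_empty
  obtain ⟨σ₀, hσ₀, hleft, hright⟩ := hΓ.inv_mem γ₀ hγ₀.1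
  have hmaps := (hΓ.aut γ₀ hγ₀.1).2.1
  refine (hy (γ₀ '' invBall Ω Γ (4 * r) y) ?_ ?_).subset fun γ hγ => ⟨hγ.1, ?_⟩
  · rintro _ ⟨x, hx, rfl⟩
    exact hmaps hx.1
  · exact (hΓ.isCompact_invBall hball).image_of_continuousOn
      ((hΓ.aut γ₀ hγ₀.1).1.continuousOn.mono fun x hx => hx.1)
  · have hγy := hnear γ hγ
    have hdist : γ y ∈ invBall Ω Γ (4 * r) (γ₀ y) := by
      refine ⟨hγy.1, fun σ hσ => ?_⟩
      linarith [dist_triangle_right (σ (γ y)) (σ (γ₀ y)) (σ k), hγy.2 σ hσ,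
        (hnear γ₀ hγ₀).2 σ hσ]
    have hmem := hΓ.image_mem_invBall hσ₀ hdist
    rw [show σ₀ (γ₀ y) = y from hleft hyΩ] at hmem
    exact ⟨σ₀ (γ y), hmem, hright hγy.1⟩

theorem IsAutGroupOn.hasDiscreteOrbit_of_mem_invBall [ProperSpace E] (hΓ : IsAutGroupOn Ω Γ)
    (hopen : IsOpen Ω) (hbdd : Bornology.IsBounded Ω) (hr : 0 < r)
    (hball : closedBall y (4 * r) ⊆ Ω) (hy : HasDiscreteOrbit Ω Γ y)
    (hx : x ∈ invBall Ω Γ r y) : HasDiscreteOrbit Ω Γ x := fun _ hKΩ hK =>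
  (hΓ.finite_image_invBall_inter hopen hbdd hr hball hy hKΩ hK).subset
    fun γ hγ => ⟨hγ.1, γ x, mem_image_of_mem γ hx, hγ.2⟩

theorem exists_closedBall_subset_of_isOpen (hopen : IsOpen Ω) (hy : y ∈ Ω) {c : ℝ} (hc : 0 < c) :
    ∃ r > 0, closedBall y (c * r) ⊆ Ω := by
  obtain ⟨R, hR, hball⟩ := Metric.nhds_basis_closedBall.mem_iff.1 (hopen.mem_nhds hy)
  exact ⟨R / c, by positivity, by rwa [mul_div_cancel₀ R hc.ne']⟩

/-- In a bounded domain, if one orbit is discrete then all of them are. -/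
theorem IsAutGroupOn.hasDiscreteOrbit_of_isPreconnected [ProperSpace E]
    (hΓ : IsAutGroupOn Ω Γ) (hopen : IsOpen Ω) (hbdd : Bornology.IsBounded Ω)
    (hconn : IsPreconnected Ω) (hx : x ∈ Ω) (hxΓ : HasDiscreteOrbit Ω Γ x) (hy : y ∈ Ω) :
    HasDiscreteOrbit Ω Γ y := by
  suffices Ω ⊆ {z ∈ Ω | HasDiscreteOrbit Ω Γ z} from (this hy).2
  refine hconn.subset_of_closure_inter_subset ?_ ⟨x, hx, hx, hxΓ⟩ ?_
  · refine isOpen_iff_mem_nhds.2 fun z hz => ?_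
    obtain ⟨r, hr, hball⟩ := exists_closedBall_subset_of_isOpen hopen hz.1 (c := 4) (by norm_num)
    filter_upwards [hΓ.invBall_mem_nhds hopen hbdd hr hz.1] with w hw
    exact ⟨hw.1, hΓ.hasDiscreteOrbit_of_mem_invBall hopen hbdd hr hball hz.2 hw⟩
  · rintro w ⟨hw, hwΩ⟩
    obtain ⟨r, hr, hball⟩ := exists_closedBall_subset_of_isOpen hopen hwΩ (c := 5) (by norm_num)
    obtain ⟨z, hzw, hzΩ, hz⟩ :=
      mem_closure_iff_nhds.1 hw _ (hΓ.invBall_mem_nhds hopen hbdd hr hwΩ)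
    have hzball : closedBall z (4 * r) ⊆ Ω :=
      (closedBall_subset_closedBall' (by
        linarith [Metric.mem_closedBall.1 (hΓ.invBall_subset_closedBall hzw)])).trans hball
    exact ⟨hwΩ, hΓ.hasDiscreteOrbit_of_mem_invBall hopen hbdd hr hzball hz
      ((mem_invBall_comm hzΩ hwΩ).1 hzw)⟩

theorem IsAutGroupOn.properlyDiscontinuousOn [ProperSpace E] (hΓ : IsAutGroupOn Ω Γ)
    (hopen : IsOpen Ω) (hbdd : Bornology.IsBounded Ω) (hconn : IsPreconnected Ω)
    (hx : x ∈ Ω) (hxΓ : HasDiscreteOrbit Ω Γ x) : ProperlyDiscontinuousOn Ω Γ := by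
  intro K₁ K₂ hK₁Ω hK₂Ω hK₁ hK₂
  refine hK₁.induction_on (p := fun s => {γ ∈ Γ | (γ '' s ∩ K₂).Nonempty}.Finite)
    (by simp) (fun s t hst ht => ht.subset fun γ hγ => ⟨hγ.1, hγ.2.mono (by gcongr)⟩)
    (fun s t hs ht => (hs.union ht).subset fun γ hγ => ?_) fun y hy => ?_
  · rw [mem_ofPred_eq, image_union, union_inter_distrib_right, union_nonempty] at hγ
    exact hγ.2.imp (fun h => ⟨hγ.1, h⟩) fun h => ⟨hγ.1, h⟩
  · have hyΩ := hK₁Ω hy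
    obtain ⟨r, hr, hball⟩ := exists_closedBall_subset_of_isOpen hopen hyΩ (c := 4) (by norm_num)
    exact ⟨invBall Ω Γ r y, mem_nhdsWithin_of_mem_nhds (hΓ.invBall_mem_nhds hopen hbdd hr hyΩ),
      hΓ.finite_image_invBall_inter hopen hbdd hr hball
        (hΓ.hasDiscreteOrbit_of_isPreconnected hopen hbdd hconn hx hxΓ hyΩ) hK₂Ω hK₂⟩

theorem hasDiscreteOrbit_of_summable {τ : E → ℝ} (hpos : ∀ z ∈ Ω, 0 < τ z)
    (hcont : ContinuousOn τ Ω) (hsum : Summable fun γ : Γ => τ (γ.1 x)) :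
    HasDiscreteOrbit Ω Γ x := by
  intro K hKΩ hK
  obtain rfl | hne := K.eq_empty_or_nonempty
  · simp
  obtain ⟨k, hk, hmin⟩ := hK.exists_isMinOn hne (hcont.mono hKΩ)
  have hfin : {γ : Γ | ¬ τ (γ.1 x) < τ k}.Finite :=
    hsum.tendsto_cofinite_zero.eventually (gt_mem_nhds (hpos k (hKΩ hk)))
  refine (hfin.image Subtype.val).subset fun γ hγ => ⟨⟨γ, hγ.1⟩, ?_, rfl⟩
  exact not_lt.2 (hmin hγ.2)

end InvBall

/-- **Proposition 1.** Let `Ω` be a bounded domain in `ℂⁿ`, `Γ` a countable subgroup of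
`Aut(Ω)`, and `τ` a positive continuous function on `Ω`. If there exists `a ∈ Ω` such
that `∑_{γ ∈ Γ} τ(γ(a)) < ∞`, then `Γ` acts properly discontinuously on `Ω`. -/
theorem summable_implies_properly_discontinuous (n : ℕ)
    (Ω : Set (EuclideanSpace ℂ (Fin n)))
    (hopen : IsOpen Ω) (hconn : IsConnected Ω) (hbdd : Bornology.IsBounded Ω)
    (Γ : Set (EuclideanSpace ℂ (Fin n) → EuclideanSpace ℂ (Fin n)))
    (hgrp : IsAutGroupOn Ω Γ) (hcount : Γ.Countable)
    (τ : EuclideanSpace ℂ (Fin n) → ℝ)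
    (hτpos : ∀ z ∈ Ω, 0 < τ z) (hτcont : ContinuousOn τ Ω)
    (a : EuclideanSpace ℂ (Fin n)) (ha : a ∈ Ω)
    (hsum : Summable fun γ : Γ => τ (γ.1 a)) :
    ProperlyDiscontinuousOn Ω Γ := by
  exact hgrp.properlyDiscontinuousOn hopen hbdd hconn.isPreconnected ha
    (hasDiscreteOrbit_of_summable hτpos hτcont hsum)

end
end

section
/- Let Ω be a bounded B-regular domain in ℂⁿ and Γ a properly discontinuous group of automorphisms of Ω. Then for every point a of a fundamental domain D, the cluster set CΓ_a of the orbit of a equals the limit set L_Γ. -/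
open Set Metric Filter MeasureTheory Topology

noncomputable section

variable {E : Type*} [NormedAddCommGroup E] [NormedSpace ℂ E]

section DiscPrinciple

variable {H : Type*} [NormedAddCommGroup H] [InnerProductSpace ℂ H]

/-- Second order Taylor expansion of a vector-valued holomorphic function. -/
theorem exists_second_order_expansion [CompleteSpace H] {φ : ℂ → H} {U : Set ℂ} {ζ : ℂ}
    (hU : U ∈ 𝓝 ζ) (hφ : DifferentiableOn ℂ φ U) :
    ∃ v q : H, ∀ κ : ℝ, 0 < κ → ∀ᶠ t : ℂ in 𝓝 0,
      ‖φ (ζ + t) - φ ζ - t • v - t ^ 2 • q‖ ≤ κ * ‖t‖ ^ 2 := by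
  have hd : DifferentiableAt ℂ (dslope φ ζ) ζ :=
    ((Complex.differentiableOn_dslope hU).2 hφ).differentiableAt hU
  refine ⟨dslope φ ζ ζ, deriv (dslope φ ζ) ζ, fun κ hκ => ?_⟩
  have h := (hasDerivAt_iff_isLittleO_nhds_zero.1 hd.hasDerivAt).def hκ
  filter_upwards [h] with t ht
  have key : φ (ζ + t) - φ ζ - t • dslope φ ζ ζ - t ^ 2 • deriv (dslope φ ζ) ζ =
      t • (dslope φ ζ (ζ + t) - dslope φ ζ ζ - t • deriv (dslope φ ζ) ζ) := by
    have h1 := sub_smul_dslope φ ζ (ζ + t)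
    rw [add_sub_cancel_left] at h1
    rw [← h1, smul_sub, smul_sub, smul_smul, sq]
  rw [key, norm_smul]
  nlinarith [norm_nonneg t]

/-- The doubled and penalized difference of a plurisubharmonic function along a holomorphic
disc and a harmonic function has no interior local maximum. -/
theorem not_isLocalMax_penalized [CompleteSpace H] {Ω : Set H} {ψ : H → ℝ} (hΩ : IsOpen Ω)
    (hψ : IsPSHOnR ψ Ω) {φ : ℂ → H} {U : Set ℂ} {ζ : ℂ} (hU : U ∈ 𝓝 ζ)
    (hφ : DifferentiableOn ℂ φ U) {f : ℂ → ℂ} (hf : Differentiable ℂ f) {N δ : ℝ}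
    (hN : 0 ≤ N) (hδ : 0 < δ) {y : H} (hy : y ∈ Ω) :
    ¬ IsLocalMax (fun p : ℂ × H =>
      ψ p.2 - N * ‖p.2 - φ p.1‖ ^ 2 - (f p.1).re + δ * ‖p.1‖ ^ 2) (ζ, y) := by
  intro hmax
  obtain ⟨v, q, hvq⟩ := exists_second_order_expansion hU hφ
  set c : H := y - φ ζ with hc
  set κ : ℝ := δ / (8 * (N * ‖c‖ + 1)) with hκdef
  have hNc : 0 ≤ N * ‖c‖ := by positivity
  have hκ : 0 < κ := by positivity
  have hκc : 2 * (N * ‖c‖ * κ) ≤ δ / 4 := by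
    have : κ * (8 * (N * ‖c‖ + 1)) = δ := by
      rw [hκdef]; field_simp
    nlinarith
  have hcont : Tendsto (fun t : ℂ => (ζ + t, y + t • v)) (𝓝 0) (𝓝 (ζ, y)) := by
    have : Continuous fun t : ℂ => (ζ + t, y + t • v) := by fun_prop
    simpa using this.tendsto 0
  have hmax' := hcont.eventually hmax
  have hin : ∀ᶠ t : ℂ in 𝓝 0, y + t • v ∈ Ω := by
    have : Continuous fun t : ℂ => y + t • v := by fun_prop
    exact this.continuousAt.eventually_mem (hΩ.mem_nhds (by simpa using hy))
  have hsmall : ∀ᶠ t : ℂ in 𝓝 0, N * (‖q‖ + κ) ^ 2 * ‖t‖ ^ 2 < δ / 4 := by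
    have : Continuous fun t : ℂ => N * (‖q‖ + κ) ^ 2 * ‖t‖ ^ 2 := by fun_prop
    exact this.continuousAt.eventually_lt continuousAt_const (by simp; positivity)
  obtain ⟨r, hr, hball⟩ := Metric.nhds_basis_closedBall.eventually_iff.1
    (hmax'.and (hin.and (hsmall.and (hvq κ hκ))))
  have hb : ∀ t : ℂ, ‖t‖ ≤ r → _ := fun t ht => hball (mem_closedBall_zero_iff.2 ht)
  set F : ℂ → ℂ := fun t => ((ψ y - δ * r ^ 2 / 2 : ℝ) : ℂ) + (f (ζ + t) - f ζ) -
    ((2 * N : ℝ) : ℂ) * (t ^ 2 * inner ℂ c q) -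
    ((2 * δ : ℝ) : ℂ) * (starRingEnd ℂ ζ * t) with hF
  have hFd : Differentiable ℂ F := by
    have : Differentiable ℂ fun t => f (ζ + t) := hf.comp (by fun_prop)
    fun_prop
  have hsub := hψ.2 y v r hr (fun w hw => (hb w hw).2.1) F hFd ?_ 0 (by simpa using hr.le)
  · have h0 : ψ y ≤ (F 0).re := by simpa using hsub
    have hF0 : (F 0).re = ψ y - δ * r ^ 2 / 2 := by
      simp only [hF, add_zero, sub_self, mul_zero, ne_eq, OfNat.ofNat_ne_zero, not_false_eq_true,
        zero_pow, zero_mul, sub_zero, Complex.ofReal_re]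
    have : 0 < δ * r ^ 2 := by positivity
    linarith
  · intro t ht
    obtain ⟨h1, -, h3, h4⟩ := hb t ht.le
    set e : H := φ (ζ + t) - φ ζ - t • v - t ^ 2 • q with he
    rw [EReal.coe_le_coe_iff]
    have hx : y + t • v - φ (ζ + t) = c - (t ^ 2 • q + e) := by rw [he, hc]; abel
    simp only [hx, ← hc] at h1
    rw [@norm_sub_sq ℂ, inner_add_right, inner_smul_right] at h1
    have hζ : ‖ζ + t‖ ^ 2 = ‖ζ‖ ^ 2 + 2 * (starRingEnd ℂ ζ * t).re + ‖t‖ ^ 2 := by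
      simp only [← Complex.normSq_eq_norm_sq, Complex.normSq_apply, Complex.add_re,
        Complex.add_im, Complex.mul_re, Complex.conj_re, Complex.conj_im]
      ring
    rw [hζ] at h1
    have hxe : ‖t ^ 2 • q + e‖ ≤ (‖q‖ + κ) * ‖t‖ ^ 2 := by
      refine (norm_add_le _ _).trans ?_
      rw [norm_smul, norm_pow]
      linarith
    have hsq : N * ‖t ^ 2 • q + e‖ ^ 2 ≤ δ / 4 * ‖t‖ ^ 2 := by
      calc N * ‖t ^ 2 • q + e‖ ^ 2 ≤ N * ((‖q‖ + κ) * ‖t‖ ^ 2) ^ 2 := by gcongr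
        _ = N * (‖q‖ + κ) ^ 2 * ‖t‖ ^ 2 * ‖t‖ ^ 2 := by ring
        _ ≤ δ / 4 * ‖t‖ ^ 2 := by gcongr
    have hce : -(2 * N * (inner ℂ c e : ℂ).re) ≤ δ / 4 * ‖t‖ ^ 2 := by
      have h5 : -(inner ℂ c e : ℂ).re ≤ ‖c‖ * ‖e‖ :=
        (neg_le_abs _).trans ((Complex.abs_re_le_norm _).trans (norm_inner_le_norm _ _))
      calc -(2 * N * (inner ℂ c e : ℂ).re) = 2 * N * -(inner ℂ c e : ℂ).re := by ring
        _ ≤ 2 * N * (‖c‖ * (κ * ‖t‖ ^ 2)) := by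
          gcongr; exact h5.trans (by gcongr)
        _ = 2 * (N * ‖c‖ * κ) * ‖t‖ ^ 2 := by ring
        _ ≤ δ / 4 * ‖t‖ ^ 2 := by gcongr
    have hFt : (F t).re = ψ y - δ * ‖t‖ ^ 2 / 2 + ((f (ζ + t)).re - (f ζ).re) -
        2 * N * (t ^ 2 * inner ℂ c q).re - 2 * δ * (starRingEnd ℂ ζ * t).re := by
      simp only [hF, Complex.add_re, Complex.sub_re, Complex.re_ofReal_mul, Complex.ofReal_re, ht]
    rw [hFt]
    simp only [RCLike.re_eq_complex_re, Complex.add_re] at h1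
    nlinarith

/-- The composition of a continuous plurisubharmonic function with a holomorphic disc is
dominated by any harmonic function dominating it on the boundary circle. -/
theorem le_re_of_le_re_on_sphere [CompleteSpace H] {Ω : Set H} {ψ : H → ℝ} (hΩ : IsOpen Ω)
    (hcpt : IsCompact (closure Ω)) (hψc : ContinuousOn ψ (closure Ω)) (hψ : IsPSHOnR ψ Ω)
    {φ : ℂ → H} {U : Set ℂ} (hU : IsOpen U) (hφ : DifferentiableOn ℂ φ U) {R : ℝ}
    (hRU : closedBall 0 R ⊆ U) (hmaps : MapsTo φ (closedBall 0 R) Ω) {f : ℂ → ℂ}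
    (hf : Differentiable ℂ f) (hb : ∀ w : ℂ, ‖w‖ = R → ψ (φ w) ≤ (f w).re)
    {z : ℂ} (hz : ‖z‖ ≤ R) : ψ (φ z) ≤ (f z).re := by
  by_contra! hlt
  obtain ⟨δ, hδ, hδR⟩ : ∃ δ : ℝ, 0 < δ ∧ δ * R ^ 2 < ψ (φ z) - (f z).re := by
    obtain ⟨δ, hδ, h⟩ := exists_pos_mul_lt (sub_pos.2 hlt) (R ^ 2)
    exact ⟨δ, hδ, by linarith⟩
  set K : Set (ℂ × H) := closedBall 0 R ×ˢ closure Ω with hK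
  have hKc : IsCompact K := (isCompact_closedBall 0 R).prod hcpt
  have hzK : (z, φ z) ∈ K :=
    ⟨mem_closedBall_zero_iff.2 hz, subset_closure (hmaps (mem_closedBall_zero_iff.2 hz))⟩
  set B : ℂ × H → ℝ := fun p => ψ p.2 - (f p.1).re + δ * ‖p.1‖ ^ 2 with hB
  have hBc : ContinuousOn B K := by
    have h1 : ContinuousOn (fun p : ℂ × H => ψ p.2) K :=
      hψc.comp continuousOn_snd fun p hp => hp.2
    have h2 : Continuous fun p : ℂ × H => (f p.1).re - δ * ‖p.1‖ ^ 2 := by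
      have := hf.continuous
      fun_prop
    exact (h1.sub h2.continuousOn).congr fun p _ => by
      simp only [hB, Pi.sub_apply]; ring
  have hφc : ContinuousOn (fun p : ℂ × H => φ p.1) K :=
    (hφ.continuousOn.mono hRU).comp continuousOn_fst fun p hp => hp.1
  have hmax : ∀ N : ℕ, ∃ p ∈ K,
      IsMaxOn (fun p => B p - N * ‖p.2 - φ p.1‖ ^ 2) K p := fun N =>
    hKc.exists_isMaxOn ⟨_, hzK⟩
      (hBc.sub (continuousOn_const.mul ((continuousOn_snd.sub hφc).norm.pow 2)))
  choose p hpK hpmax using hmax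
  have hlow : ∀ N, B (z, φ z) + N * ‖(p N).2 - φ (p N).1‖ ^ 2 ≤ B (p N) := fun N => by
    have := hpmax N hzK
    simp only [mem_ofPred_eq, sub_self, norm_zero] at this
    linarith
  set 𝒰 : Ultrafilter ℕ := hyperfilter ℕ
  have htop : Tendsto (fun N : ℕ => (N : ℝ)) 𝒰 atTop :=
    tendsto_natCast_atTop_atTop.mono_left Nat.hyperfilter_le_atTop
  obtain ⟨⟨ζ, y⟩, hpK', hlim⟩ := isCompact_iff_ultrafilter_le_nhds'.1 hKc (𝒰.map p)
    (Eventually.of_forall hpK : ∀ᶠ N in (𝒰 : Filter ℕ), p N ∈ K)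
  have hlim : Tendsto p 𝒰 (𝓝 (ζ, y)) := hlim
  have hlimK : Tendsto p 𝒰 (𝓝[K] (ζ, y)) :=
    tendsto_nhdsWithin_iff.2 ⟨hlim, Eventually.of_forall hpK⟩
  have hBlim : Tendsto (fun N => B (p N)) 𝒰 (𝓝 (B (ζ, y))) := (hBc _ hpK').tendsto.comp hlimK
  have hdist : Tendsto (fun N => ‖(p N).2 - φ (p N).1‖ ^ 2) 𝒰 (𝓝 (‖y - φ ζ‖ ^ 2)) :=
    (((continuousOn_snd.sub hφc).norm.pow 2) _ hpK').tendsto.comp hlimK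
  have hyζ : y = φ ζ := by
    by_contra hne
    have hpos : 0 < ‖y - φ ζ‖ ^ 2 := by
      have := norm_pos_iff.2 (sub_ne_zero.2 hne)
      positivity
    have hinf := tendsto_atTop_mono hlow
      (tendsto_atTop_add_const_left _ (B (z, φ z)) (htop.atTop_mul_pos hpos hdist))
    exact not_tendsto_nhds_of_tendsto_atTop hinf _ hBlim
  have hge : B (z, φ z) ≤ B (ζ, y) := ge_of_tendsto hBlim <| Eventually.of_forall fun N =>
    le_trans (le_add_of_nonneg_right (by positivity)) (hlow N)
  have hζR : ‖ζ‖ < R := by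
    refine lt_of_le_of_ne (mem_closedBall_zero_iff.1 hpK'.1) fun h => ?_
    have h1 := hb ζ h
    have h2 : 0 ≤ δ * ‖z‖ ^ 2 := by positivity
    simp only [hB, hyζ, h] at hge
    linarith
  have hyΩ : y ∈ Ω := hyζ ▸ hmaps hpK'.1
  have hnhds : ball (0 : ℂ) R ×ˢ Ω ∈ 𝓝 (ζ, y) :=
    (isOpen_ball.prod hΩ).mem_nhds ⟨mem_ball_zero_iff.2 hζR, hyΩ⟩
  obtain ⟨N, hN⟩ := (hlim.eventually hnhds).exists
  refine not_isLocalMax_penalized hΩ hψ (hU.mem_nhds (hRU (ball_subset_closedBall hN.1))) hφ hf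
    (Nat.cast_nonneg N) hδ hN.2 ?_
  have hKN : K ∈ 𝓝 (p N) := mem_of_superset ((isOpen_ball.prod hΩ).mem_nhds hN)
    (prod_mono ball_subset_closedBall subset_closure)
  filter_upwards [hKN] with x hx
  have := hpmax N hx
  simp only [mem_ofPred_eq, hB] at this
  linarith

/-- Quantitative maximum principle on a disc of radius `1 / 4`: if a nonpositive
plurisubharmonic function is at most `-m` on the arc `1 / 16 ≤ re t` of the boundary circle,
then it is at most `-m / 64` at the center. -/
theorem center_le_of_le_on_arc [CompleteSpace H] {Ω : Set H} {ψ : H → ℝ} (hΩ : IsOpen Ω)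
    (hcpt : IsCompact (closure Ω)) (hψc : ContinuousOn ψ (closure Ω)) (hψ : IsPSHOnR ψ Ω)
    (hψ0 : ∀ x ∈ Ω, ψ x ≤ 0) {φ : ℂ → H} {U : Set ℂ} (hU : IsOpen U)
    (hφ : DifferentiableOn ℂ φ U) (hRU : closedBall 0 (1 / 4) ⊆ U)
    (hmaps : MapsTo φ (closedBall 0 (1 / 4)) Ω) {m : ℝ} (hm : 0 ≤ m)
    (harc : ∀ t : ℂ, ‖t‖ = 1 / 4 → 1 / 16 ≤ t.re → ψ (φ t) ≤ -m) :
    ψ (φ 0) ≤ -m / 64 := by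
  have hre : ∀ t : ℂ, ((m : ℂ) * (-t - 2 * t ^ 2 - 1 / 64)).re =
      m * (-t.re - 2 * (t.re ^ 2 - t.im ^ 2) - 1 / 64) := by
    intro t
    have h1 : (-t - 2 * t ^ 2 - 1 / 64 : ℂ).re =
        -t.re - 2 * (t.re ^ 2 - t.im ^ 2) - 1 / 64 := by
      have h2 : (1 / 64 : ℂ) = ((1 / 64 : ℝ) : ℂ) := by push_cast; rfl
      have h3 : (2 : ℂ) = ((2 : ℝ) : ℂ) := by push_cast; rfl
      rw [h2, h3, Complex.sub_re, Complex.sub_re, Complex.neg_re, Complex.re_ofReal_mul,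
        Complex.ofReal_re, sq, Complex.mul_re]
      ring
    rw [Complex.re_ofReal_mul, h1]
  have h := le_re_of_le_re_on_sphere hΩ hcpt hψc hψ hU hφ hRU hmaps
    (f := fun t => (m : ℂ) * (-t - 2 * t ^ 2 - 1 / 64)) (by fun_prop) ?_
    (z := 0) (by norm_num)
  · rw [hre] at h
    simp only [Complex.zero_re, Complex.zero_im] at h
    linarith
  · intro t ht
    rw [hre]
    have hn : t.re ^ 2 + t.im ^ 2 = 1 / 16 := by
      have := Complex.normSq_apply t
      rw [Complex.normSq_eq_norm_sq, ht] at this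
      nlinarith
    have hx1 : -(1 / 4) ≤ t.re := by nlinarith [sq_nonneg t.im]
    have hx2 : t.re ≤ 1 / 4 := by nlinarith [sq_nonneg t.im]
    by_cases hx : 1 / 16 ≤ t.re
    · refine (harc t ht hx).trans ?_
      have : -1 ≤ -t.re - 2 * (t.re ^ 2 - t.im ^ 2) - 1 / 64 := by nlinarith
      nlinarith
    · refine (hψ0 _ (hmaps (mem_closedBall_zero_iff.2 ht.le))).trans (mul_nonneg hm ?_)
      push Not at hx
      nlinarith

end DiscPrinciple

section Propagation

variable {H : Type*} [NormedAddCommGroup H] [InnerProductSpace ℂ H]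

/-- Holomorphic self-maps of a bounded open set are equi-Lipschitz at every point. -/
theorem exists_equiLipschitz_at {Ω : Set H} (hΩ : IsOpen Ω) (hbdd : Bornology.IsBounded Ω)
    {x : H} (hx : x ∈ Ω) : ∃ r > 0, ∃ L : ℝ, 0 ≤ L ∧ ∀ f : H → H, DifferentiableOn ℂ f Ω →
      MapsTo f Ω Ω → ∀ y ∈ ball x r, dist (f y) (f x) ≤ L * dist y x := by
  obtain ⟨r, hr, hball⟩ := Metric.isOpen_iff.1 hΩ x hx
  refine ⟨r, hr, diam Ω / r, by positivity, fun f hf hm y hy => ?_⟩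
  exact Complex.dist_le_div_mul_dist_of_mapsTo_ball (hf.mono hball)
    (fun z hz => dist_le_diam_of_mem hbdd (hm (hball hz)) (hm hx)) hy

theorem tendsto_dist_apply_of_tendsto {Ω : Set H} (hΩ : IsOpen Ω)
    (hbdd : Bornology.IsBounded Ω) {ι : Type*} {l : Filter ι} {σ : ι → H → H}
    (hd : ∀ k, DifferentiableOn ℂ (σ k) Ω) (hm : ∀ k, MapsTo (σ k) Ω Ω) {x : H} (hx : x ∈ Ω)
    {y : ι → H} (hy : Tendsto y l (𝓝 x)) :
    Tendsto (fun k => dist (σ k (y k)) (σ k x)) l (𝓝 0) := by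
  obtain ⟨r, hr, L, -, hL⟩ := exists_equiLipschitz_at hΩ hbdd hx
  have h0 : Tendsto (fun k => L * dist (y k) x) l (𝓝 0) := by
    simpa using (tendsto_iff_dist_tendsto_zero.1 hy).const_mul L
  refine squeeze_zero' (Eventually.of_forall fun k => dist_nonneg) ?_ h0
  filter_upwards [hy.eventually (ball_mem_nhds x hr)] with k hk
  exact hL _ (hd k) (hm k) _ hk

/-- If holomorphic self-maps of `Ω` converge at one point to a boundary point admitting a
barrier, then they converge to it at every point of `Ω`. -/
theorem tendsto_of_tendsto_of_isBarrierAt [ProperSpace H] {Ω : Set H} (hΩ : IsOpen Ω)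
    (hconn : IsPreconnected Ω) (hbdd : Bornology.IsBounded Ω) {w : H} {ψ : H → ℝ}
    (hψ : IsBarrierAt Ω w ψ) {ι : Type*} {𝒰 : Ultrafilter ι} {σ : ι → H → H}
    (hd : ∀ k, DifferentiableOn ℂ (σ k) Ω) (hm : ∀ k, MapsTo (σ k) Ω Ω) {c : H} (hc : c ∈ Ω)
    (hcw : Tendsto (fun k => σ k c) 𝒰 (𝓝 w)) {a : H} (ha : a ∈ Ω) :
    Tendsto (fun k => σ k a) 𝒰 (𝓝 w) := by
  obtain ⟨hψc, hψp, hψw, hψneg⟩ := hψ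
  have hcpt : IsCompact (closure Ω) := hbdd.isCompact_closure
  have hψ0 : ∀ x ∈ Ω, ψ x ≤ 0 := fun x hx => by
    rcases eq_or_ne x w with rfl | hne
    · exact hψw.le
    · exact (hψneg x (subset_closure hx) hne).le
  have hψlim : ∀ y ∈ closure Ω, ∀ x : ι → H, (∀ k, x k ∈ Ω) → Tendsto x 𝒰 (𝓝 y) →
      Tendsto (fun k => ψ (x k)) 𝒰 (𝓝 (ψ y)) := fun y hy x hx hxy =>
    (hψc y hy).tendsto.comp
      (tendsto_nhdsWithin_iff.2 ⟨hxy, Eventually.of_forall fun k => subset_closure (hx k)⟩)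
  set Z : Set H := {x ∈ Ω | Tendsto (fun k => σ k x) 𝒰 (𝓝 w)} with hZ
  have hclosed : closure Z ∩ Ω ⊆ Z := by
    rintro x ⟨hxZ, hx⟩
    refine ⟨hx, Metric.tendsto_nhds.2 fun ε hε => ?_⟩
    obtain ⟨r, hr, L, hL0, hL⟩ := exists_equiLipschitz_at hΩ hbdd hx
    obtain ⟨η, hη, hηL⟩ := exists_pos_mul_lt (half_pos hε) L
    obtain ⟨y, hyZ, hxy⟩ := Metric.mem_closure_iff.1 hxZ (min r η) (lt_min hr hη)
    rw [dist_comm] at hxy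
    filter_upwards [Metric.tendsto_nhds.1 hyZ.2 (ε / 2) (half_pos hε)] with k hk
    have h1 := hL (σ k) (hd k) (hm k) y (hxy.trans_le (min_le_left _ _))
    have h2 : L * dist y x ≤ L * η := by
      gcongr; exact (hxy.trans_le (min_le_right _ _)).le
    have h3 := dist_triangle_left (σ k x) w (σ k y)
    linarith
  have hopen : IsOpen Z := by
    by_contra hno
    obtain ⟨z₀, hz₀, hnot⟩ : ∃ z₀ ∈ Z, Z ∉ 𝓝 z₀ := by
      simpa [isOpen_iff_mem_nhds] using hno
    obtain ⟨ρ, hρ, hρΩ⟩ : ∃ ρ : ℝ, 0 < ρ ∧ closedBall z₀ (3 * ρ) ⊆ Ω := by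
      obtain ⟨ε, hε, h⟩ := Metric.nhds_basis_closedBall.mem_iff.1 (hΩ.mem_nhds hz₀.1)
      exact ⟨ε / 3, by positivity, by rwa [mul_div_cancel₀ _ (by norm_num)]⟩
    obtain ⟨b, hbρ, hbZ⟩ : ∃ b ∈ ball z₀ ρ, b ∉ Z := by
      by_contra! h
      exact hnot (mem_of_superset (ball_mem_nhds z₀ hρ) h)
    have hZ'c : IsClosed (Z ∩ closedBall z₀ (3 * ρ)) := by
      refine isClosed_of_closure_subset fun x hx => ?_
      have hxb : x ∈ closedBall z₀ (3 * ρ) :=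
        closure_minimal inter_subset_right isClosed_closedBall hx
      exact ⟨hclosed ⟨closure_mono inter_subset_left hx, hρΩ hxb⟩, hxb⟩
    have hz₀' : z₀ ∈ Z ∩ closedBall z₀ (3 * ρ) := ⟨hz₀, mem_closedBall_self (by positivity)⟩
    obtain ⟨z, hz, hdz⟩ := hZ'c.exists_infDist_eq_dist ⟨z₀, hz₀'⟩ b
    have hbz : dist b z < ρ := by
      rw [← hdz]
      exact (infDist_le_dist_of_mem hz₀').trans_lt hbρ
    set v : H := b - z with hv
    have hvn : ‖v‖ = dist b z := (dist_eq_norm b z).symm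
    have hv0 : 0 < ‖v‖ := norm_pos_iff.2 (sub_ne_zero.2 fun h => hbZ (h ▸ hz.1))
    have hdisc : ∀ t : ℂ, ‖t‖ < 1 → z + t • v ∈ closedBall z₀ (3 * ρ) := fun t ht => by
      have h1 : dist (z + t • v) z ≤ ρ := by
        rw [dist_self_add_left, norm_smul]
        nlinarith [norm_nonneg t]
      have h2 := dist_triangle (z + t • v) z z₀
      have h3 := dist_triangle_left z z₀ b
      rw [mem_closedBall]
      have h4 : dist b z₀ < ρ := hbρ
      linarith
    have hnotZ : ∀ t : ℂ, ‖t‖ = 1 / 4 → 1 / 16 ≤ t.re → z + t • v ∉ Z := fun t ht htr hmem => by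
      have h1 : infDist b (Z ∩ closedBall z₀ (3 * ρ)) ≤ dist b (z + t • v) :=
        infDist_le_dist_of_mem ⟨hmem, hdisc t (by rw [ht]; norm_num)⟩
      have h2 : b - (z + t • v) = (1 - t) • v := by rw [hv]; module
      rw [hdz, dist_eq_norm b (z + t • v), h2, norm_smul, ← hvn] at h1
      have h3 : 1 ≤ ‖1 - t‖ := by
        by_contra! h
        nlinarith
      have h4 : ‖1 - t‖ ^ 2 = 1 - 2 * t.re + ‖t‖ ^ 2 := by
        simp only [← Complex.normSq_eq_norm_sq, Complex.normSq_apply, Complex.sub_re,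
          Complex.sub_im, Complex.one_re, Complex.one_im]
        ring
      rw [ht] at h4
      nlinarith
    set A : Set ℂ := closedBall 0 (1 / 4) ∩ {t | ‖t‖ = 1 / 4 ∧ 1 / 16 ≤ t.re} with hA
    have hAc : IsCompact A := by
      refine (isCompact_closedBall 0 _).inter_right (IsClosed.inter ?_ ?_)
      · exact isClosed_eq continuous_norm continuous_const
      · exact isClosed_le continuous_const Complex.continuous_re
    have hAne : A.Nonempty := by
      refine ⟨((1 / 4 : ℝ) : ℂ), ?_, ?_, ?_⟩
      · simp
      · rw [Complex.norm_real]; norm_num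
      · rw [Complex.ofReal_re]; norm_num
    have hAΩ : ∀ t ∈ A, z + t • v ∈ Ω := fun t ht =>
      hρΩ (hdisc t (by rw [ht.2.1]; norm_num))
    have hline : Continuous fun t : ℂ => z + t • v := by fun_prop
    have hmaxk : ∀ k, ∃ t ∈ A, IsMaxOn (fun t => ψ (σ k (z + t • v))) A t := fun k => by
      refine hAc.exists_isMaxOn hAne (hψc.comp ?_ fun t ht => subset_closure (hm k (hAΩ t ht)))
      exact (hd k).continuousOn.comp hline.continuousOn hAΩ
    choose t htA htmax using hmaxk
    have hcenter : ∀ k, ψ (σ k z) ≤ ψ (σ k (z + t k • v)) / 64 := fun k => by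
      have h := center_le_of_le_on_arc hΩ hcpt hψc hψp hψ0 (φ := fun s => σ k (z + s • v))
        (U := (fun s : ℂ => z + s • v) ⁻¹' Ω) (hΩ.preimage hline)
        ((hd k).comp (by fun_prop) (mapsTo_preimage _ _))
        (fun s hs => hρΩ (hdisc s ((mem_closedBall_zero_iff.1 hs).trans_lt (by norm_num))))
        (fun s hs => hm k
          (hρΩ (hdisc s ((mem_closedBall_zero_iff.1 hs).trans_lt (by norm_num)))))
        (m := -ψ (σ k (z + t k • v)))
        (neg_nonneg.2 (hψ0 _ (hm k (hAΩ _ (htA k)))))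
        (fun s hs hsr => by
          rw [neg_neg]
          exact htmax k ⟨mem_closedBall_zero_iff.2 hs.le, hs, hsr⟩)
      simpa using h
    obtain ⟨s, hsA, hs⟩ := isCompact_iff_ultrafilter_le_nhds'.1 hAc (𝒰.map t)
      (Eventually.of_forall htA : ∀ᶠ k in (𝒰 : Filter ι), t k ∈ A)
    have hs : Tendsto t 𝒰 (𝓝 s) := hs
    have hxs := hAΩ s hsA
    obtain ⟨y, hyΩ, hy⟩ := isCompact_iff_ultrafilter_le_nhds'.1 hcpt
      (𝒰.map fun k => σ k (z + s • v))
      (Eventually.of_forall fun k => subset_closure (hm k hxs) :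
        ∀ᶠ k in (𝒰 : Filter ι), σ k (z + s • v) ∈ closure Ω)
    have hy : Tendsto (fun k => σ k (z + s • v)) 𝒰 (𝓝 y) := hy
    have hyw : y ≠ w := fun h => hnotZ s hsA.2.1 hsA.2.2 ⟨hxs, h ▸ hy⟩
    have hmove : Tendsto (fun k => σ k (z + t k • v)) 𝒰 (𝓝 y) :=
      tendsto_of_tendsto_of_dist hy <| by
        simpa only [dist_comm, Function.comp_apply] using tendsto_dist_apply_of_tendsto hΩ hbdd hd hm hxs
          ((hline.tendsto s).comp hs)
    have hw : w ∈ closure Ω :=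
      mem_closure_of_tendsto hcw (Eventually.of_forall fun k => hm k hc)
    have hle := le_of_tendsto_of_tendsto' (hψlim w hw _ (fun k => hm k hz.1.1) hz.1.2)
      ((hψlim y hyΩ _ (fun k => hm k (hAΩ _ (htA k))) hmove).div_const 64) hcenter
    have := hψneg y hyΩ hyw
    rw [hψw] at hle
    linarith
  exact (hconn.subset_of_closure_inter_subset hopen ⟨c, hc, hc, hcw⟩ hclosed ha).2

end Propagation

/-- **Proposition 2.** Let `Ω` be a bounded B-regular domain in `ℂⁿ` and `Γ` a properly
discontinuous group of automorphisms of `Ω`. Then `CΓ_a = L_Γ` for every point `a` of a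
fundamental domain `D`. -/
theorem cluster_set_eq_limitSet_of_bregular (n : ℕ)
    (Ω : Set (EuclideanSpace ℂ (Fin n)))
    (hopen : IsOpen Ω) (hconn : IsConnected Ω) (hbdd : Bornology.IsBounded Ω)
    (hreg : BRegular Ω)
    (Γ : Set (EuclideanSpace ℂ (Fin n) → EuclideanSpace ℂ (Fin n)))
    (hgrp : IsAutGroupOn Ω Γ) (hpd : ProperlyDiscontinuousOn Ω Γ)
    (D : Set (EuclideanSpace ℂ (Fin n))) (hD : IsFundamentalDomainOn Ω Γ D) :
    ∀ a ∈ D, clusterPtsOfOrbit Γ a = limitSet Ω Γ := by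
  intro a ha
  have haΩ : a ∈ Ω := hD.1 ha
  refine Subset.antisymm (fun b hb => ?_) ?_
  · have hb : AccPt b (𝓟 (orbitOf Γ a)) := hb
    have hborb : b ∈ closure (orbitOf Γ a) := mem_closure_iff_clusterPt.2 hb.clusterPt
    have horb : orbitOf Γ a ⊆ Ω := by
      rintro _ ⟨γ, hγ, rfl⟩
      exact (hgrp.aut γ hγ).2.1 haΩ
    have hbΩ : b ∉ Ω := by
      intro hbΩ
      obtain ⟨r, hr, hrΩ⟩ := Metric.nhds_basis_closedBall.mem_iff.1 (hopen.mem_nhds hbΩ)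
      have hfin := hpd {a} (closedBall b r) (singleton_subset_iff.2 haΩ) hrΩ isCompact_singleton
        (isCompact_closedBall b r)
      have hacc : AccPt b (𝓟 (closedBall b r ∩ orbitOf Γ a)) :=
        hb.nhds_inter (closedBall_mem_nhds b hr)
      refine Set.Infinite.of_accPt hacc ((hfin.image fun γ => γ a).subset ?_)
      rintro _ ⟨hx, γ, hγ, rfl⟩
      exact ⟨γ, ⟨hγ, γ a, ⟨a, rfl, rfl⟩, hx⟩, rfl⟩
    refine ⟨⟨closure_mono horb hborb, by rwa [hopen.interior_eq]⟩, {a},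
      singleton_subset_iff.2 haΩ, isCompact_singleton, ?_⟩
    obtain ⟨z, hz, hzb⟩ := mem_closure_iff_seq_limit.1 hborb
    choose γ hγ hγz using hz
    choose σ hσ hσγ _ using fun k => hgrp.inv_mem (γ k) (hγ k)
    refine ⟨z, fun k => horb ⟨γ k, hγ k, hγz k⟩, hzb, σ, hσ, fun k => ?_⟩
    rw [← hγz k]
    exact hσγ k haΩ
  · rintro w ⟨hwf, K, hKΩ, hK, z, hzΩ, hzw, γ, hγ, hγK⟩
    obtain ⟨ψ, hψ⟩ := hreg w hwf
    have hwΩ : w ∉ Ω := fun h => hwf.2 (by rwa [hopen.interior_eq])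
    choose σ hσ hσγ _ using fun k => hgrp.inv_mem (γ k) (hγ k)
    have hd : ∀ k, DifferentiableOn ℂ (σ k) Ω := fun k => (hgrp.aut _ (hσ k)).1
    have hm : ∀ k, MapsTo (σ k) Ω Ω := fun k => (hgrp.aut _ (hσ k)).2.1
    set 𝒰 : Ultrafilter ℕ := hyperfilter ℕ
    obtain ⟨c, hcK, hc⟩ := isCompact_iff_ultrafilter_le_nhds'.1 hK (𝒰.map fun k => γ k (z k))
      (Eventually.of_forall hγK : ∀ᶠ k in (𝒰 : Filter ℕ), γ k (z k) ∈ K)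
    have hc : Tendsto (fun k => γ k (z k)) 𝒰 (𝓝 c) := hc
    have hz𝒰 : Tendsto z 𝒰 (𝓝 w) := hzw.mono_left Nat.hyperfilter_le_atTop
    have hσc : Tendsto (fun k => σ k c) 𝒰 (𝓝 w) := by
      refine tendsto_of_tendsto_of_dist hz𝒰 ?_
      refine (tendsto_dist_apply_of_tendsto hopen hbdd hd hm (hKΩ hcK) hc).congr fun k => ?_
      rw [show σ k (γ k (z k)) = z k from hσγ k (hzΩ k)]
    have hσa := tendsto_of_tendsto_of_isBarrierAt hopen hconn.isPreconnected hbdd hψ hd hm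
      (hKΩ hcK) hσc haΩ
    refine accPt_iff_frequently.2 (hσa.frequently (Eventually.of_forall fun k => ?_).frequently)
    exact ⟨fun h => hwΩ (h ▸ hm k haΩ), σ k, hσ k, rfl⟩

end
end
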